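/- arXiv:2201.03461 — 2 statements merged into one kernel-verified Lean document; each statement's English description precedes it below -/
import Mathlib

section
/- Let L be a hitomezashi loop that has at least one horizontal stitch that is an indent or an outdent of L, and let i0 be the largest longitude at which L has such a stitch. Then i0 is an outdent longitude of L, i.e., every horizontal stitch of L at longitude i0 is an outdent. -/
/-- A stitch is a unit segment of the grid: `vert i j` is the vertical segment from
`(i,j)` to `(i,j+1)`; `horiz i j` is the horizontal segment from `(i,j)` to `(i+1,j)`. -/
inductive Stitch : Type
  | vert : ℤ → ℤ → Stitch
  | horiz : ℤ → ℤ → Stitch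
  deriving DecidableEq

/-- Membership of a stitch in the hitomezashi pattern with labels `ε` (vertical lines)
and `η` (horizontal lines). -/
def Stitch.InPattern (ε η : ℤ → ZMod 2) : Stitch → Prop
  | .vert i j => (j : ZMod 2) = ε i
  | .horiz i j => (i : ZMod 2) = η j

/-- The stitch as a subset of the plane. -/
def Stitch.seg : Stitch → Set (ℝ × ℝ)
  | .vert i j => segment ℝ ((i : ℝ), (j : ℝ)) ((i : ℝ), (j : ℝ) + 1)
  | .horiz i j => segment ℝ ((i : ℝ), (j : ℝ)) ((i : ℝ) + 1, (j : ℝ))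

/-- The union of the segments of a set of stitches. -/
def curveOf (S : Set Stitch) : Set (ℝ × ℝ) := ⋃ s ∈ S, s.seg

/-- `C` is a simple closed curve: it is homeomorphic to a circle. -/
def IsCircle (C : Set (ℝ × ℝ)) : Prop :=
  Nonempty (C ≃ₜ Metric.sphere (0 : ℝ × ℝ) 1)

/-- The interior of a closed curve `C`: the union of the bounded connected
components of its complement. -/
def intOf (C : Set (ℝ × ℝ)) : Set (ℝ × ℝ) :=
  {p | p ∉ C ∧ Bornology.IsBounded (connectedComponentIn Cᶜ p)}

/-- The exterior of a closed curve `C`: the union of the unbounded connected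
components of its complement. -/
def extOf (C : Set (ℝ × ℝ)) : Set (ℝ × ℝ) :=
  {p | p ∉ C ∧ ¬ Bornology.IsBounded (connectedComponentIn Cᶜ p)}

/-- The open unit cell with southwest corner `(i,j)`. -/
def cell (i j : ℤ) : Set (ℝ × ℝ) :=
  Set.Ioo (i : ℝ) ((i : ℝ) + 1) ×ˢ Set.Ioo (j : ℝ) ((j : ℝ) + 1)

/-- A hitomezashi loop in the pattern with labels `ε`, `η`: a (finite) set of stitches
of the pattern whose union is a simple closed curve. -/
structure HLoop (ε η : ℤ → ZMod 2) where
  stitches : Finset Stitch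
  inPattern : ∀ s ∈ stitches, s.InPattern ε η
  isCircle : IsCircle (curveOf ↑stitches)

/-- The horizontal stitch `horiz i j` is an indent of `L`: the two vertical stitches of `L`
adjacent to it have the same latitude and the unit cell between them lies in the exterior. -/
def IndentH {ε η : ℤ → ZMod 2} (L : HLoop ε η) (i j : ℤ) : Prop :=
  Stitch.horiz i j ∈ L.stitches ∧ ∃ j' : ℤ, (j' = j ∨ j' = j - 1) ∧
    Stitch.vert i j' ∈ L.stitches ∧ Stitch.vert (i+1) j' ∈ L.stitches ∧
    cell i j' ⊆ extOf (curveOf ↑L.stitches)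

/-- The horizontal stitch `horiz i j` is an outdent of `L`. -/
def OutdentH {ε η : ℤ → ZMod 2} (L : HLoop ε η) (i j : ℤ) : Prop :=
  Stitch.horiz i j ∈ L.stitches ∧ ∃ j' : ℤ, (j' = j ∨ j' = j - 1) ∧
    Stitch.vert i j' ∈ L.stitches ∧ Stitch.vert (i+1) j' ∈ L.stitches ∧
    cell i j' ⊆ intOf (curveOf ↑L.stitches)

/-- The horizontal stitch `horiz i j` is a nondent of `L`: the two adjacent vertical
stitches have different latitudes. -/
def NondentH {ε η : ℤ → ZMod 2} (L : HLoop ε η) (i j : ℤ) : Prop :=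
  Stitch.horiz i j ∈ L.stitches ∧ ∃ j1 j2 : ℤ, (j1 = j ∨ j1 = j - 1) ∧ (j2 = j ∨ j2 = j - 1) ∧
    j1 ≠ j2 ∧ Stitch.vert i j1 ∈ L.stitches ∧ Stitch.vert (i+1) j2 ∈ L.stitches

/-- The vertical stitch `vert i j` is an indent of `L`. -/
def IndentV {ε η : ℤ → ZMod 2} (L : HLoop ε η) (i j : ℤ) : Prop :=
  Stitch.vert i j ∈ L.stitches ∧ ∃ i' : ℤ, (i' = i ∨ i' = i - 1) ∧
    Stitch.horiz i' j ∈ L.stitches ∧ Stitch.horiz i' (j+1) ∈ L.stitches ∧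
    cell i' j ⊆ extOf (curveOf ↑L.stitches)

/-- The vertical stitch `vert i j` is an outdent of `L`. -/
def OutdentV {ε η : ℤ → ZMod 2} (L : HLoop ε η) (i j : ℤ) : Prop :=
  Stitch.vert i j ∈ L.stitches ∧ ∃ i' : ℤ, (i' = i ∨ i' = i - 1) ∧
    Stitch.horiz i' j ∈ L.stitches ∧ Stitch.horiz i' (j+1) ∈ L.stitches ∧
    cell i' j ⊆ intOf (curveOf ↑L.stitches)

/-- The vertical stitch `vert i j` is a nondent of `L`. -/
def NondentV {ε η : ℤ → ZMod 2} (L : HLoop ε η) (i j : ℤ) : Prop :=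
  Stitch.vert i j ∈ L.stitches ∧ ∃ i1 i2 : ℤ, (i1 = i ∨ i1 = i - 1) ∧ (i2 = i ∨ i2 = i - 1) ∧
    i1 ≠ i2 ∧ Stitch.horiz i1 j ∈ L.stitches ∧ Stitch.horiz i2 (j+1) ∈ L.stitches

open Set Topology

namespace Hitomezashi

/-! ### Topology of the circle -/

/-- Removing a point from the unit sphere of the plane leaves a connected set: it is the radial
projection of the complement of a ray, which is star-shaped. -/
lemma isPreconnected_sphere_diff_singleton (p : ℝ × ℝ) (hp : ‖p‖ = 1) :
    IsPreconnected (Metric.sphere (0 : ℝ × ℝ) 1 \ {p}) := by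
  have hp0 : p ≠ 0 := by
    rintro rfl
    simp at hp
  set U : Set (ℝ × ℝ) := {x | ∀ t : ℝ, 0 ≤ t → x ≠ t • p} with hU
  have hmem : -p ∈ U := by
    intro t ht h
    have h' : (t + 1) • p = 0 := by
      rw [add_smul, one_smul, ← h, neg_add_cancel]
    rcases smul_eq_zero.1 h' with h' | h'
    · linarith
    · exact hp0 h'
  have hstar : StarConvex ℝ (-p) U := by
    intro x hx a b ha hb hab t ht h
    rcases hb.eq_or_lt with rfl | hb
    · have ha1 : a = 1 := by linarith
      subst ha1
      exact hmem t ht (by simpa using h)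
    · refine hx (b⁻¹ * (t + a)) (by positivity) ?_
      have h' : b • x = (t + a) • p := by
        rw [add_smul, ← h, smul_neg]
        abel
      rw [mul_smul, ← h', smul_smul, inv_mul_cancel₀ hb.ne', one_smul]
  have hne : ∀ x ∈ U, x ≠ 0 := fun x hx h => hx 0 le_rfl (by simpa using h)
  have himage : (fun x : ℝ × ℝ => ‖x‖⁻¹ • x) '' U = Metric.sphere (0 : ℝ × ℝ) 1 \ {p} := by
    ext y
    constructor
    · rintro ⟨x, hx, rfl⟩
      have hx0 := norm_ne_zero_iff.2 (hne x hx)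
      refine ⟨by simp [norm_smul, hx0], fun h => hx ‖x‖ (norm_nonneg x) ?_⟩
      rw [mem_singleton_iff] at h
      rw [← h, smul_smul, mul_inv_cancel₀ hx0, one_smul]
    · rintro ⟨hy, hyp⟩
      have hy1 : ‖y‖ = 1 := by simpa using hy
      refine ⟨y, fun t ht h => hyp ?_, by simp [hy1]⟩
      have ht1 : t = 1 := by
        rw [h, norm_smul, hp, mul_one, Real.norm_of_nonneg ht] at hy1
        exact hy1
      simpa [ht1] using h
  rw [← himage]
  refine (hstar.isPathConnected hmem).isConnected.isPreconnected.image _ ?_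
  exact (continuousOn_id.norm.inv₀ fun x hx => norm_ne_zero_iff.2 (hne x hx)).smul continuousOn_id

lemma _root_.IsCircle.isPreconnected {C : Set (ℝ × ℝ)} (hC : IsCircle C) : IsPreconnected C := by
  obtain ⟨e⟩ := hC
  have hs : IsPreconnected (Metric.sphere (0 : ℝ × ℝ) 1) :=
    isPreconnected_sphere (by rw [← Module.finrank_eq_rank]; simp) 0 1
  rw [isPreconnected_iff_preconnectedSpace] at hs ⊢
  exact e.symm.surjective.denseRange.preconnectedSpace e.symm.continuous

lemma _root_.IsCircle.isPreconnected_diff_singleton {C : Set (ℝ × ℝ)} (hC : IsCircle C)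
    {m : ℝ × ℝ} (hm : m ∈ C) : IsPreconnected (C \ {m}) := by
  obtain ⟨e⟩ := hC
  have hs := isPreconnected_sphere_diff_singleton (e ⟨m, hm⟩) (by simp)
  have hs' : IsPreconnected ({e ⟨m, hm⟩}ᶜ : Set (Metric.sphere (0 : ℝ × ℝ) 1)) := by
    rw [← IsInducing.subtypeVal.isPreconnected_image]
    convert hs using 1
    ext y
    simp only [mem_image, mem_compl_iff, mem_singleton_iff, Subtype.exists, mem_sdiff,
      exists_and_right, exists_eq_right, Subtype.ext_iff]
    exact ⟨fun ⟨h, h'⟩ => ⟨h, h'⟩, fun ⟨h, h'⟩ => ⟨h, h'⟩⟩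
  have h := hs'.image (fun y => (e.symm y : ℝ × ℝ))
    (continuous_subtype_val.comp e.symm.continuous).continuousOn
  convert h using 1
  ext y
  constructor
  · rintro ⟨hy, hym⟩
    refine ⟨e ⟨y, hy⟩, fun h => hym ?_, by simp⟩
    have := e.injective h
    exact congrArg Subtype.val this
  · rintro ⟨z, hz, rfl⟩
    refine ⟨(e.symm z).2, fun h => hz ?_⟩
    have : e.symm z = ⟨m, hm⟩ := Subtype.ext h
    rw [mem_singleton_iff, ← this, e.apply_symm_apply]

/-! ### Stitches as segments -/

lemma mem_seg_vert {i j : ℤ} {p : ℝ × ℝ} :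
    p ∈ (Stitch.vert i j).seg ↔ p.1 = i ∧ (j : ℝ) ≤ p.2 ∧ p.2 ≤ j + 1 := by
  obtain ⟨x, y⟩ := p
  rw [Stitch.seg, ← Prod.image_mk_segment_right, segment_eq_Icc (by linarith)]
  simp only [mem_image, mem_Icc, Prod.mk.injEq]
  constructor
  · rintro ⟨z, hz, rfl, rfl⟩
    exact ⟨rfl, hz⟩
  · rintro ⟨rfl, h⟩
    exact ⟨y, h, rfl, rfl⟩

lemma mem_seg_horiz {i j : ℤ} {p : ℝ × ℝ} :
    p ∈ (Stitch.horiz i j).seg ↔ ((i : ℝ) ≤ p.1 ∧ p.1 ≤ i + 1) ∧ p.2 = j := by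
  obtain ⟨x, y⟩ := p
  rw [Stitch.seg, ← Prod.image_mk_segment_left, segment_eq_Icc (by linarith)]
  simp only [mem_image, mem_Icc, Prod.mk.injEq]
  constructor
  · rintro ⟨z, hz, rfl, rfl⟩
    exact ⟨hz, rfl⟩
  · rintro ⟨h, rfl⟩
    exact ⟨x, h, rfl, rfl⟩

lemma isClosed_seg (s : Stitch) : IsClosed s.seg := by
  cases s <;>
  · rw [Stitch.seg, segment_eq_image]
    exact (isCompact_Icc.image (by fun_prop)).isClosed

lemma seg_nonempty (s : Stitch) : s.seg.Nonempty := by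
  cases s with
  | vert i j => exact ⟨(i, j), mem_seg_vert.2 ⟨rfl, le_rfl, by simp⟩⟩
  | horiz i j => exact ⟨(i, j), mem_seg_horiz.2 ⟨⟨le_rfl, by simp⟩, rfl⟩⟩

lemma mem_curveOf {S : Set Stitch} {p : ℝ × ℝ} : p ∈ curveOf S ↔ ∃ s ∈ S, p ∈ s.seg := by
  simp [curveOf]

lemma isClosed_curveOf {S : Set Stitch} (hS : S.Finite) : IsClosed (curveOf S) :=
  hS.isClosed_biUnion fun s _ => isClosed_seg s

/-- A property of stitches of a loop that is inherited by touching stitches is constant. -/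
lemma exists_touching {S : Finset Stitch} (hS : IsCircle (curveOf ↑S)) (P : Stitch → Prop)
    {s t : Stitch} (hs : s ∈ S) (ht : t ∈ S) (hPs : P s) (hPt : ¬ P t) :
    ∃ s' ∈ S, ∃ t' ∈ S, P s' ∧ ¬ P t' ∧ (s'.seg ∩ t'.seg).Nonempty := by
  have h := isPreconnected_closed_iff.1 hS.isPreconnected
    (curveOf {s | s ∈ S ∧ P s}) (curveOf {s | s ∈ S ∧ ¬ P s})
    (isClosed_curveOf (S.finite_toSet.subset fun _ h => h.1))
    (isClosed_curveOf (S.finite_toSet.subset fun _ h => h.1))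
    (by
      intro p hp
      obtain ⟨u, hu, hpu⟩ := mem_curveOf.1 hp
      by_cases hPu : P u
      · exact Or.inl (mem_curveOf.2 ⟨u, ⟨hu, hPu⟩, hpu⟩)
      · exact Or.inr (mem_curveOf.2 ⟨u, ⟨hu, hPu⟩, hpu⟩))
    (by
      obtain ⟨p, hp⟩ := seg_nonempty s
      exact ⟨p, mem_curveOf.2 ⟨s, hs, hp⟩, mem_curveOf.2 ⟨s, ⟨hs, hPs⟩, hp⟩⟩)
    (by
      obtain ⟨p, hp⟩ := seg_nonempty t
      exact ⟨p, mem_curveOf.2 ⟨t, ht, hp⟩, mem_curveOf.2 ⟨t, ⟨ht, hPt⟩, hp⟩⟩)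
  obtain ⟨p, -, hp1, hp2⟩ := h
  obtain ⟨s', ⟨hs', hPs'⟩, hps'⟩ := mem_curveOf.1 hp1
  obtain ⟨t', ⟨ht', hPt'⟩, hpt'⟩ := mem_curveOf.1 hp2
  exact ⟨s', hs', t', ht', hPs', hPt', p, hps', hpt'⟩

/-- A loop has no dead ends: cutting a stitch `s` at a point `m` of height `h m`, the part of `s`
below `m` cannot be disjoint from all other stitches. -/
lemma exists_touching_below {S : Finset Stitch} (hS : IsCircle (curveOf ↑S)) {s : Stitch}
    (hs : s ∈ S) (h : ℝ × ℝ → ℝ) (hcont : Continuous h) {m v w : ℝ × ℝ} (hm : m ∈ s.seg)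
    (hv : v ∈ s.seg) (hw : w ∈ s.seg) (hvm : h v < h m) (hmw : h m < h w)
    (huniq : ∀ p ∈ s.seg, h p = h m → p = m) :
    ∃ t ∈ S, t ≠ s ∧ ∃ p ∈ t.seg, p ∈ s.seg ∧ h p ≤ h m := by
  have hsub : ∀ p ∈ s.seg, p ∈ curveOf ↑S := fun p hp => mem_curveOf.2 ⟨s, hs, hp⟩
  have key := isPreconnected_closed_iff.1 (hS.isPreconnected_diff_singleton (hsub m hm))
    (s.seg ∩ {p | h p ≤ h m}) (s.seg ∩ {p | h m ≤ h p} ∪ curveOf {t | t ∈ S ∧ t ≠ s})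
    ((isClosed_seg s).inter (isClosed_le hcont continuous_const))
    (((isClosed_seg s).inter (isClosed_le continuous_const hcont)).union
      (isClosed_curveOf (S.finite_toSet.subset fun _ h => h.1)))
    (by
      rintro p ⟨hp, -⟩
      obtain ⟨u, hu, hpu⟩ := mem_curveOf.1 hp
      by_cases hus : u = s
      · subst hus
        rcases le_total (h p) (h m) with hle | hle
        · exact Or.inl ⟨hpu, hle⟩
        · exact Or.inr (Or.inl ⟨hpu, hle⟩)
      · exact Or.inr (Or.inr (mem_curveOf.2 ⟨u, ⟨hu, hus⟩, hpu⟩)))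
    ⟨v, ⟨hsub v hv, fun hh => hvm.ne (congrArg h hh)⟩, hv, hvm.le⟩
    ⟨w, ⟨hsub w hw, fun hh => hmw.ne' (congrArg h hh)⟩, Or.inl ⟨hw, hmw.le⟩⟩
  obtain ⟨p, ⟨-, hpm⟩, ⟨hps, hle⟩, hp⟩ := key
  rcases hp with ⟨-, hge⟩ | hp
  · exact absurd (huniq p hps (le_antisymm hle hge)) hpm
  · obtain ⟨t, ⟨ht, hts⟩, hpt⟩ := mem_curveOf.1 hp
    exact ⟨t, ht, hts, p, hpt, hps, hle⟩

/-! ### Adjacent stitches of a loop -/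

variable {ε η : ℤ → ZMod 2} (L : HLoop ε η)

lemma vert_parity {i j k : ℤ} (hj : Stitch.vert i j ∈ L.stitches)
    (hk : Stitch.vert i k ∈ L.stitches) : j % 2 = k % 2 := by
  have h1 : (j : ZMod 2) = ε i := L.inPattern _ hj
  have h2 : (k : ZMod 2) = ε i := L.inPattern _ hk
  exact (ZMod.intCast_eq_intCast_iff' j k 2).1 (h1.trans h2.symm)

lemma horiz_parity {i k j : ℤ} (hi : Stitch.horiz i j ∈ L.stitches)
    (hk : Stitch.horiz k j ∈ L.stitches) : i % 2 = k % 2 := by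
  have h1 : (i : ZMod 2) = η j := L.inPattern _ hi
  have h2 : (k : ZMod 2) = η j := L.inPattern _ hk
  exact (ZMod.intCast_eq_intCast_iff' i k 2).1 (h1.trans h2.symm)

lemma vert_of_horiz_left {i j : ℤ} (hs : Stitch.horiz i j ∈ L.stitches) :
    Stitch.vert i j ∈ L.stitches ∨ Stitch.vert i (j - 1) ∈ L.stitches := by
  obtain ⟨t, ht, hts, p, hpt, hps, hle⟩ := exists_touching_below L.isCircle hs Prod.fst
    continuous_fst (m := (i + 1 / 2, j)) (v := (i, j)) (w := (i + 1, j))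
    (mem_seg_horiz.2 ⟨⟨by simp, by norm_num⟩, rfl⟩) (mem_seg_horiz.2 ⟨⟨by simp, by simp⟩, rfl⟩)
    (mem_seg_horiz.2 ⟨⟨by simp, by simp⟩, rfl⟩) (by norm_num) (by norm_num)
    (fun p hp h => Prod.ext h (mem_seg_horiz.1 hp).2)
  obtain ⟨⟨h1, h2⟩, h3⟩ := mem_seg_horiz.1 hps
  dsimp only at hle
  cases t with
  | vert a b =>
    obtain ⟨h4, h5, h6⟩ := mem_seg_vert.1 hpt
    rw [h4] at h1 hle
    rw [h3] at h5 h6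
    have ha : a = i := by
      have : (a : ℝ) < i + 1 := by linarith
      norm_cast at h1 this
      omega
    subst ha
    norm_cast at h5 h6
    obtain rfl | rfl : b = j ∨ b = j - 1 := by omega
    · exact Or.inl ht
    · exact Or.inr ht
  | horiz a b =>
    exfalso
    obtain ⟨⟨h4, h5⟩, h6⟩ := mem_seg_horiz.1 hpt
    have hb : b = j := by exact_mod_cast h6.symm.trans h3
    subst hb
    have := horiz_parity L ht hs
    have h7 : (a : ℝ) < i + 1 := by linarith
    have h8 : (i : ℝ) ≤ a + 1 := by linarith
    norm_cast at h7 h8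
    exact hts (by congr 1; omega)

lemma vert_of_horiz_right {i j : ℤ} (hs : Stitch.horiz i j ∈ L.stitches) :
    Stitch.vert (i + 1) j ∈ L.stitches ∨ Stitch.vert (i + 1) (j - 1) ∈ L.stitches := by
  obtain ⟨t, ht, hts, p, hpt, hps, hle⟩ := exists_touching_below L.isCircle hs (fun p => -p.1)
    (by fun_prop) (m := (i + 1 / 2, j)) (v := (i + 1, j)) (w := (i, j))
    (mem_seg_horiz.2 ⟨⟨by simp, by norm_num⟩, rfl⟩) (mem_seg_horiz.2 ⟨⟨by simp, by simp⟩, rfl⟩)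
    (mem_seg_horiz.2 ⟨⟨by simp, by simp⟩, rfl⟩) (by norm_num) (by norm_num)
    (fun p hp h => Prod.ext (neg_injective h) (mem_seg_horiz.1 hp).2)
  obtain ⟨⟨h1, h2⟩, h3⟩ := mem_seg_horiz.1 hps
  dsimp only at hle
  cases t with
  | vert a b =>
    obtain ⟨h4, h5, h6⟩ := mem_seg_vert.1 hpt
    rw [h4] at h2 hle
    rw [h3] at h5 h6
    have ha : a = i + 1 := by
      have : (i : ℝ) < a := by linarith
      norm_cast at h2 this
      omega
    subst ha
    norm_cast at h5 h6
    obtain rfl | rfl : b = j ∨ b = j - 1 := by omega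
    · exact Or.inl ht
    · exact Or.inr ht
  | horiz a b =>
    exfalso
    obtain ⟨⟨h4, h5⟩, h6⟩ := mem_seg_horiz.1 hpt
    have hb : b = j := by exact_mod_cast h6.symm.trans h3
    subst hb
    have := horiz_parity L ht hs
    have h7 : (i : ℝ) < a + 1 := by linarith
    have h8 : (a : ℝ) ≤ i + 1 := by linarith
    norm_cast at h7 h8
    exact hts (by congr 1; omega)

lemma horiz_of_vert_bot {i j : ℤ} (hs : Stitch.vert i j ∈ L.stitches) :
    Stitch.horiz i j ∈ L.stitches ∨ Stitch.horiz (i - 1) j ∈ L.stitches := by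
  obtain ⟨t, ht, hts, p, hpt, hps, hle⟩ := exists_touching_below L.isCircle hs Prod.snd
    continuous_snd (m := (i, j + 1 / 2)) (v := (i, j)) (w := (i, j + 1))
    (mem_seg_vert.2 ⟨rfl, by simp, by norm_num⟩) (mem_seg_vert.2 ⟨rfl, by simp, by simp⟩)
    (mem_seg_vert.2 ⟨rfl, by simp, by simp⟩) (by norm_num) (by norm_num)
    (fun p hp h => Prod.ext (mem_seg_vert.1 hp).1 h)
  obtain ⟨h3, h1, h2⟩ := mem_seg_vert.1 hps
  dsimp only at hle
  cases t with
  | horiz a b =>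
    obtain ⟨⟨h5, h6⟩, h4⟩ := mem_seg_horiz.1 hpt
    rw [h4] at h1 hle
    rw [h3] at h5 h6
    have hb : b = j := by
      have : (b : ℝ) < j + 1 := by linarith
      norm_cast at h1 this
      omega
    subst hb
    norm_cast at h5 h6
    obtain rfl | rfl : a = i ∨ a = i - 1 := by omega
    · exact Or.inl ht
    · exact Or.inr ht
  | vert a b =>
    exfalso
    obtain ⟨h6, h4, h5⟩ := mem_seg_vert.1 hpt
    have ha : a = i := by exact_mod_cast h6.symm.trans h3
    subst ha
    have := vert_parity L ht hs
    have h7 : (b : ℝ) < j + 1 := by linarith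
    have h8 : (j : ℝ) ≤ b + 1 := by linarith
    norm_cast at h7 h8
    exact hts (by congr 1; omega)

lemma horiz_of_vert_top {i j : ℤ} (hs : Stitch.vert i j ∈ L.stitches) :
    Stitch.horiz i (j + 1) ∈ L.stitches ∨ Stitch.horiz (i - 1) (j + 1) ∈ L.stitches := by
  obtain ⟨t, ht, hts, p, hpt, hps, hle⟩ := exists_touching_below L.isCircle hs (fun p => -p.2)
    (by fun_prop) (m := (i, j + 1 / 2)) (v := (i, j + 1)) (w := (i, j))
    (mem_seg_vert.2 ⟨rfl, by simp, by norm_num⟩) (mem_seg_vert.2 ⟨rfl, by simp, by simp⟩)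
    (mem_seg_vert.2 ⟨rfl, by simp, by simp⟩) (by norm_num) (by norm_num)
    (fun p hp h => Prod.ext (mem_seg_vert.1 hp).1 (neg_injective h))
  obtain ⟨h3, h1, h2⟩ := mem_seg_vert.1 hps
  dsimp only at hle
  cases t with
  | horiz a b =>
    obtain ⟨⟨h5, h6⟩, h4⟩ := mem_seg_horiz.1 hpt
    rw [h4] at h2 hle
    rw [h3] at h5 h6
    have hb : b = j + 1 := by
      have : (j : ℝ) < b := by linarith
      norm_cast at h2 this
      omega
    subst hb
    norm_cast at h5 h6
    obtain rfl | rfl : a = i ∨ a = i - 1 := by omega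
    · exact Or.inl ht
    · exact Or.inr ht
  | vert a b =>
    exfalso
    obtain ⟨h6, h4, h5⟩ := mem_seg_vert.1 hpt
    have ha : a = i := by exact_mod_cast h6.symm.trans h3
    subst ha
    have := vert_parity L ht hs
    have h7 : (j : ℝ) < b + 1 := by linarith
    have h8 : (b : ℝ) ≤ j + 1 := by linarith
    norm_cast at h7 h8
    exact hts (by congr 1; omega)

/-! ### The crossing parity of a cell -/

/-- The number modulo 2 of stitches of `S` crossed by the downward ray from the center of the
cell with southwest corner `(i,j)`. -/
def crossing (S : Finset Stitch) (i j : ℤ) : ZMod 2 :=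
  ∑ s ∈ S, match s with
    | .vert _ _ => 0
    | .horiz a b => if a = i ∧ b ≤ j then 1 else 0

lemma crossing_horiz (S : Finset Stitch) (i j : ℤ) :
    crossing S i j = crossing S i (j - 1) + if Stitch.horiz i j ∈ S then 1 else 0 := by
  rw [← Finset.sum_ite_eq' S (Stitch.horiz i j) (fun _ => (1 : ZMod 2)), crossing, crossing,
    ← Finset.sum_add_distrib]
  refine Finset.sum_congr rfl fun s _ => ?_
  cases s with
  | vert a b => simp
  | horiz a b =>
    simp only [Stitch.horiz.injEq]
    split_ifs <;> first | omega | simp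

lemma crossing_eq_zero {S : Finset Stitch} {i j : ℤ}
    (h : ∀ k ≤ j, Stitch.horiz i k ∉ S) : crossing S i j = 0 := by
  refine Finset.sum_eq_zero fun s hs => ?_
  cases s with
  | vert a b => rfl
  | horiz a b =>
    dsimp only
    rw [if_neg]
    rintro ⟨rfl, hb⟩
    exact h b hb hs

lemma exists_bound (S : Finset Stitch) : ∃ N : ℤ,
    (∀ i j, Stitch.vert i j ∈ S → |i| ≤ N ∧ |j| ≤ N) ∧
    (∀ i j, Stitch.horiz i j ∈ S → |i| ≤ N ∧ |j| ≤ N) := by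
  obtain ⟨N, hN⟩ := (S.image fun s => match s with
    | .vert a b => |a| + |b|
    | .horiz a b => |a| + |b|).exists_le
  refine ⟨N, fun i j h => ?_, fun i j h => ?_⟩ <;>
  · have h' := hN _ (Finset.mem_image_of_mem _ h)
    dsimp only at h'
    have := abs_nonneg i
    have := abs_nonneg j
    omega

lemma crossing_vert (i j : ℤ) :
    crossing L.stitches i j =
      crossing L.stitches (i - 1) j + if Stitch.vert i j ∈ L.stitches then 1 else 0 := by
  obtain ⟨N, hNv, hNh⟩ := exists_bound L.stitches
  have low : ∀ j < -N, crossing L.stitches i j =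
      crossing L.stitches (i - 1) j + if Stitch.vert i j ∈ L.stitches then 1 else 0 := by
    intro j hj
    rw [crossing_eq_zero, crossing_eq_zero, if_neg, add_zero]
    · intro h
      have := abs_le.1 (hNv _ _ h).2
      omega
    all_goals
      intro k hk h
      have := abs_le.1 (hNh _ _ h).2
      omega
  rcases lt_or_ge j (-N) with hj | hj
  · exact low j hj
  have hj' : -N - 1 ≤ j := by omega
  induction j, hj' using Int.leInduction with
  | base => exact low _ (by omega)
  | succ j hj1 ih =>
    have ih' : crossing L.stitches i j =
        crossing L.stitches (i - 1) j + if Stitch.vert i j ∈ L.stitches then 1 else 0 := by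
      rcases lt_or_ge j (-N) with hj2 | hj2
      · exact low j hj2
      · exact ih hj2
    rw [crossing_horiz _ i (j + 1), crossing_horiz _ (i - 1) (j + 1), add_sub_cancel_right, ih']
    have e1 : Stitch.vert i j ∈ L.stitches → Stitch.vert i (j + 1) ∉ L.stitches := by
      intro h h'
      have := vert_parity L h h'
      omega
    have e2 : Stitch.horiz i (j + 1) ∈ L.stitches → Stitch.horiz (i - 1) (j + 1) ∉ L.stitches := by
      intro h h'
      have := horiz_parity L h h'
      omega
    have e3 := horiz_of_vert_top L (i := i) (j := j)
    have e4 := horiz_of_vert_bot L (i := i) (j := j + 1)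
    have e5 := vert_of_horiz_left L (i := i) (j := j + 1)
    have e6 := vert_of_horiz_right L (i := i - 1) (j := j + 1)
    rw [sub_add_cancel, add_sub_cancel_right] at e6
    rw [add_sub_cancel_right] at e5
    have two : (1 : ZMod 2) + 1 = 0 := rfl
    clear low ih ih' hNv hNh
    split_ifs <;>
      first | ring1 | linear_combination two | linear_combination -two | grind only

lemma exists_crossing_bound : ∃ N : ℤ, ∀ i j, crossing L.stitches i j ≠ 0 → |i| ≤ N ∧ |j| ≤ N := by
  obtain ⟨N, hNv, hNh⟩ := exists_bound L.stitches
  have hi : ∀ i j, N < |i| → crossing L.stitches i j = 0 := fun i j h =>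
    crossing_eq_zero fun k _ hk => by
      have := (hNh _ _ hk).1
      omega
  refine ⟨N, fun i j h => ⟨?_, ?_⟩⟩
  · by_contra! hlt
    exact h (hi i j hlt)
  · by_contra! hlt
    rcases lt_abs.1 hlt with hj | hj
    · have shift : ∀ n : ℕ, crossing L.stitches i j = crossing L.stitches (i - n) j := by
        intro n
        induction n with
        | zero => simp
        | succ n ih =>
          rw [ih, crossing_vert, if_neg, add_zero]
          · push_cast
            rw [sub_sub]
          · intro h
            have := abs_le.1 (hNv _ _ h).2
            omega
      refine h ((shift (i + |N| + 1).toNat).trans (hi _ _ (lt_abs.2 (Or.inr ?_))))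
      have := Int.self_le_toNat (i + |N| + 1)
      have := le_abs_self N
      omega
    · refine h (crossing_eq_zero fun k hk h => ?_)
      have := abs_le.1 (hNh _ _ h).2
      omega

/-! ### Cells with odd crossing parity are interior -/

/-- Off the curve, the crossing parities of all cells whose closure contains a point agree. -/
lemma crossing_eq_of_notMem {x y : ℝ} (hp : (x, y) ∉ curveOf (↑L.stitches : Set Stitch)) {u v : ℤ}
    (hu : ⌈x⌉ - 1 ≤ u) (hu' : u ≤ ⌊x⌋) (hv : ⌈y⌉ - 1 ≤ v) (hv' : v ≤ ⌊y⌋) :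
    crossing L.stitches u v = crossing L.stitches ⌊x⌋ ⌊y⌋ := by
  have hxc := Int.le_ceil x
  have hxf := Int.floor_le x
  have hyc := Int.le_ceil y
  have hyf := Int.floor_le y
  have hxc' := Int.lt_floor_add_one x
  have hyc' := Int.lt_floor_add_one y
  have hu1 : x ≤ u + 1 := by
    have : ((⌈x⌉ - 1 : ℤ) : ℝ) ≤ u := by exact_mod_cast hu
    push_cast at this
    linarith
  have hv1 : y ≤ v + 1 := by
    have : ((⌈y⌉ - 1 : ℤ) : ℝ) ≤ v := by exact_mod_cast hv
    push_cast at this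
    linarith
  have hu2 : (u : ℝ) ≤ ⌊x⌋ := by exact_mod_cast hu'
  have hv2 : (v : ℝ) ≤ ⌊y⌋ := by exact_mod_cast hv'
  have h1 : crossing L.stitches u v = crossing L.stitches ⌊x⌋ v := by
    rcases hu'.eq_or_lt with h | h
    · rw [h]
    · have h1 : (u : ℝ) + 1 ≤ ⌊x⌋ := by exact_mod_cast h
      have hux : u = ⌊x⌋ - 1 := by
        have : (⌊x⌋ : ℝ) ≤ u + 1 := by linarith
        norm_cast at this
        omega
      rw [crossing_vert L ⌊x⌋ v, if_neg, add_zero, hux]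
      intro hs
      refine hp (mem_curveOf.2 ⟨_, hs, mem_seg_vert.2 ⟨?_, ?_, ?_⟩⟩) <;> dsimp only <;> linarith
  rw [h1]
  rcases hv'.eq_or_lt with h | h
  · rw [h]
  · have h1 : (v : ℝ) + 1 ≤ ⌊y⌋ := by exact_mod_cast h
    have hvy : v = ⌊y⌋ - 1 := by
      have : (⌊y⌋ : ℝ) ≤ v + 1 := by linarith
      norm_cast at this
      omega
    rw [crossing_horiz _ ⌊x⌋ ⌊y⌋, if_neg, add_zero, hvy]
    intro hs
    refine hp (mem_curveOf.2 ⟨_, hs, mem_seg_horiz.2 ⟨⟨?_, ?_⟩, ?_⟩⟩) <;> dsimp only <;> linarith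

lemma eventually_floor_mem (a : ℝ) : ∀ᶠ x in 𝓝 a, ⌈a⌉ - 1 ≤ ⌊x⌋ ∧ ⌊x⌋ ≤ ⌊a⌋ := by
  have h1 : ((⌈a⌉ : ℝ) - 1) < a := by linarith [Int.ceil_lt_add_one a]
  filter_upwards [lt_mem_nhds h1, gt_mem_nhds (Int.lt_floor_add_one a)] with x hx1 hx2
  refine ⟨Int.le_floor.2 ?_, Int.lt_add_one_iff.1 (Int.floor_lt.2 ?_)⟩
  · push_cast
    exact hx1.le
  · push_cast
    exact hx2

lemma crossing_floor_continuousOn :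
    ContinuousOn (fun p : ℝ × ℝ => decide (crossing L.stitches ⌊p.1⌋ ⌊p.2⌋ = 0))
      (curveOf (↑L.stitches : Set Stitch))ᶜ := by
  rintro ⟨x, y⟩ hp
  refine ContinuousAt.continuousWithinAt ?_
  have h : ∀ᶠ q : ℝ × ℝ in 𝓝 (x, y),
      decide (crossing L.stitches ⌊q.1⌋ ⌊q.2⌋ = 0) = decide (crossing L.stitches ⌊x⌋ ⌊y⌋ = 0) := by
    rw [nhds_prod_eq]
    filter_upwards [(eventually_floor_mem x).prod_mk (eventually_floor_mem y)] with q hq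
    rw [crossing_eq_of_notMem L hp hq.1.1 hq.1.2 hq.2.1 hq.2.2]
  exact continuousAt_const.congr (h.mono fun q hq => hq.symm)

lemma notMem_curveOf_of_mem_cell (S : Set Stitch) {i j : ℤ} {p : ℝ × ℝ} (hp : p ∈ cell i j) :
    p ∉ curveOf S := by
  intro h
  obtain ⟨⟨h1, h2⟩, h3, h4⟩ := hp
  obtain ⟨s, -, hs⟩ := mem_curveOf.1 h
  cases s with
  | vert a b =>
    rw [(mem_seg_vert.1 hs).1] at h1 h2
    norm_cast at h1 h2
    omega
  | horiz a b =>
    rw [(mem_seg_horiz.1 hs).2] at h3 h4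
    norm_cast at h3 h4
    omega

lemma cell_subset_intOf {i j : ℤ} (h : crossing L.stitches i j ≠ 0) :
    cell i j ⊆ intOf (curveOf ↑L.stitches) := by
  intro p hp
  have hpC := notMem_curveOf_of_mem_cell (↑L.stitches) hp
  refine ⟨hpC, ?_⟩
  obtain ⟨N, hN⟩ := exists_crossing_bound L
  refine (Metric.isBounded_Icc ((-N : ℝ), (-N : ℝ)) ((N + 1 : ℝ), (N + 1 : ℝ))).subset ?_
  intro q hq
  have heq := (isPreconnected_connectedComponentIn (F := (curveOf (↑L.stitches : Set Stitch))ᶜ)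
    (x := p)).constant ((crossing_floor_continuousOn L).mono (connectedComponentIn_subset _ _)) hq
    (mem_connectedComponentIn hpC)
  obtain ⟨⟨h1, h2⟩, h3, h4⟩ := hp
  rw [Int.floor_eq_iff.2 ⟨h1.le, h2⟩, Int.floor_eq_iff.2 ⟨h3.le, h4⟩, decide_eq_decide] at heq
  obtain ⟨hx, hy⟩ := hN _ _ fun hq0 => h (heq.1 hq0)
  rw [abs_le] at hx hy
  have hx1 : (-N : ℝ) ≤ ⌊q.1⌋ := by exact_mod_cast hx.1
  have hx2 : (⌊q.1⌋ : ℝ) ≤ N := by exact_mod_cast hx.2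
  have hy1 : (-N : ℝ) ≤ ⌊q.2⌋ := by exact_mod_cast hy.1
  have hy2 : (⌊q.2⌋ : ℝ) ≤ N := by exact_mod_cast hy.2
  have := Int.floor_le q.1
  have := Int.lt_floor_add_one q.1
  have := Int.floor_le q.2
  have := Int.lt_floor_add_one q.2
  refine ⟨⟨?_, ?_⟩, ?_, ?_⟩ <;> dsimp only <;> linarith

lemma cell_subset_extOf_or_intOf (S : Set Stitch) (i j : ℤ) :
    cell i j ⊆ extOf (curveOf S) ∨ cell i j ⊆ intOf (curveOf S) := by
  have hsub : cell i j ⊆ (curveOf S)ᶜ := fun p hp => notMem_curveOf_of_mem_cell S hp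
  have hconn : IsPreconnected (cell i j) := isPreconnected_Ioo.prod isPreconnected_Ioo
  have hcomp : ∀ p ∈ cell i j, ∀ q ∈ cell i j,
      connectedComponentIn (curveOf S)ᶜ p = connectedComponentIn (curveOf S)ᶜ q :=
    fun p hp q hq => connectedComponentIn_eq (hconn.subset_connectedComponentIn hp hsub hq)
  by_contra! h
  obtain ⟨⟨p, hp, hpe⟩, q, hq, hqi⟩ := h.imp not_subset.1 not_subset.1
  have hpb : Bornology.IsBounded (connectedComponentIn (curveOf S)ᶜ p) := by
    by_contra hb
    exact hpe ⟨hsub hp, hb⟩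
  rw [hcomp p hp q hq] at hpb
  exact hqi ⟨hsub hq, hpb⟩

/-! ### Orientation of a loop -/

/-- Orient horizontal stitches away from their endpoint with even coordinate sum, and vertical
stitches away from their endpoint with odd coordinate sum; this orients every loop coherently.
`leftCrossing S s` is the crossing parity of the cell to the left of `s`. -/
def leftCrossing (S : Finset Stitch) : Stitch → ZMod 2
  | .vert i j => if (i + j) % 2 = 0 then crossing S i j else crossing S (i - 1) j
  | .horiz i j => if (i + j) % 2 = 0 then crossing S i j else crossing S i (j - 1)

lemma leftCrossing_eq_of_horiz_vert {i j a b : ℤ} (hs : Stitch.horiz i j ∈ L.stitches)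
    (ht : Stitch.vert a b ∈ L.stitches)
    (hst : ((Stitch.horiz i j).seg ∩ (Stitch.vert a b).seg).Nonempty) :
    leftCrossing L.stitches (Stitch.horiz i j) = leftCrossing L.stitches (Stitch.vert a b) := by
  obtain ⟨p, hp1, hp2⟩ := hst
  obtain ⟨⟨h1, h2⟩, h3⟩ := mem_seg_horiz.1 hp1
  obtain ⟨h4, h5, h6⟩ := mem_seg_vert.1 hp2
  rw [h4] at h1 h2
  rw [h3] at h5 h6
  norm_cast at h1 h2 h5 h6
  have two : (1 : ZMod 2) + 1 = 0 := rfl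
  have hH := crossing_horiz L.stitches i j
  have hV := crossing_vert L a b
  rw [if_pos hs] at hH
  rw [if_pos ht] at hV
  simp only [leftCrossing]
  obtain rfl | rfl : a = i ∨ a = i + 1 := by omega
  all_goals
    obtain rfl | rfl : b = j ∨ b = j - 1 := by omega
    all_goals
      try rw [add_sub_cancel_right] at *
      split_ifs <;> first | omega | grind

lemma leftCrossing_const {s t : Stitch} (hs : s ∈ L.stitches) (ht : t ∈ L.stitches) :
    leftCrossing L.stitches s = leftCrossing L.stitches t := by
  by_contra hne
  obtain ⟨s', hs', t', ht', hPs, hPt, hst⟩ := exists_touching L.isCircle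
    (fun u => leftCrossing L.stitches s = leftCrossing L.stitches u) hs ht rfl hne
  refine hPt (hPs.trans ?_)
  cases s' with
  | vert i j =>
    cases t' with
    | vert a b =>
      obtain ⟨p, hp1, hp2⟩ := hst
      obtain ⟨h1, h2, h3⟩ := mem_seg_vert.1 hp1
      obtain ⟨h4, h5, h6⟩ := mem_seg_vert.1 hp2
      have hai : a = i := by exact_mod_cast h4.symm.trans h1
      subst hai
      have h7 : (j : ℝ) ≤ b + 1 := h2.trans h6
      have h8 : (b : ℝ) ≤ j + 1 := h5.trans h3
      norm_cast at h7 h8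
      have := vert_parity L hs' ht'
      rw [show j = b by omega]
    | horiz a b => exact (leftCrossing_eq_of_horiz_vert L ht' hs' (inter_comm _ _ ▸ hst)).symm
  | horiz i j =>
    cases t' with
    | vert a b => exact leftCrossing_eq_of_horiz_vert L hs' ht' hst
    | horiz a b =>
      obtain ⟨p, hp1, hp2⟩ := hst
      obtain ⟨⟨h2, h3⟩, h1⟩ := mem_seg_horiz.1 hp1
      obtain ⟨⟨h5, h6⟩, h4⟩ := mem_seg_horiz.1 hp2
      have hbj : b = j := by exact_mod_cast h4.symm.trans h1
      subst hbj
      have h7 : (i : ℝ) ≤ a + 1 := h2.trans h6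
      have h8 : (a : ℝ) ≤ i + 1 := h5.trans h3
      norm_cast at h7 h8
      have := horiz_parity L hs' ht'
      rw [show i = a by omega]

/-- Stitches at the same longitude and with heights of the same parity have cells of the same
crossing parity above them; with heights of opposite parity, the cell above one has the crossing
parity of the cell below the other. -/
lemma crossing_eq_of_same_longitude {i j k : ℤ} (hj : Stitch.horiz i j ∈ L.stitches)
    (hk : Stitch.horiz i k ∈ L.stitches) :
    crossing L.stitches i j =
      if j % 2 = k % 2 then crossing L.stitches i k else crossing L.stitches i (k - 1) := by
  have h := leftCrossing_const L hj hk
  have h1 := crossing_horiz L.stitches i j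
  have h2 := crossing_horiz L.stitches i k
  rw [if_pos hj] at h1
  rw [if_pos hk] at h2
  simp only [leftCrossing] at h
  have two : (1 : ZMod 2) + 1 = 0 := rfl
  split_ifs at h ⊢ <;> first | omega | grind

/-! ### The largest longitude with dents -/

lemma exists_lowest {i j : ℤ} (hj : Stitch.horiz i j ∈ L.stitches) :
    ∃ k, Stitch.horiz i k ∈ L.stitches ∧ ∀ l, Stitch.horiz i l ∈ L.stitches → k ≤ l := by
  obtain ⟨N, -, hN⟩ := exists_bound L.stitches
  obtain ⟨k, hk, hle⟩ := Int.exists_least_of_bdd (P := fun k => Stitch.horiz i k ∈ L.stitches)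
    ⟨-N, fun l hl => (abs_le.1 (hN _ _ hl).2).1⟩ ⟨j, hj⟩
  exact ⟨k, hk, hle⟩

/-- If no stitch to the right of longitude `i` is a dent, then the part of the loop to the right
of that longitude consists of vertically monotone strands, so the lowest stitch at longitude `i`
is followed on its right by an ascending stitch. -/
lemma vert_not_below_lowest {i k : ℤ}
    (hdent : ∀ a b c : ℤ, i < a → Stitch.horiz a b ∈ L.stitches → (c = b ∨ c = b - 1) →
      Stitch.vert a c ∈ L.stitches → Stitch.vert (a + 1) c ∉ L.stitches)
    (hk : ∀ l, Stitch.horiz i l ∈ L.stitches → k ≤ l) :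
    Stitch.vert (i + 1) (k - 1) ∉ L.stitches := by
  intro hV
  obtain ⟨N, hN, -⟩ := exists_bound L.stitches
  obtain ⟨c, ⟨a, ha, hck, hac⟩, hmin⟩ := Int.exists_least_of_bdd
    (P := fun c => ∃ a, i < a ∧ c < k ∧ Stitch.vert a c ∈ L.stitches)
    ⟨-N, fun l ⟨_, _, _, hl⟩ => (abs_le.1 (hN _ _ hl).2).1⟩ ⟨k - 1, i + 1, by omega, by omega, hV⟩
  have hlow : ∀ a, i < a → Stitch.vert a (c - 1) ∉ L.stitches := by
    intro a ha h
    have := hmin (c - 1) ⟨a, ha, by omega, h⟩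
    omega
  rcases horiz_of_vert_bot L hac with h | h
  · exact hdent a c c ha h (Or.inl rfl) hac
      ((vert_of_horiz_right L h).resolve_right (hlow _ (by omega)))
  · rcases (show i ≤ a - 1 by omega).eq_or_lt with hia | hia
    · have := hk c (hia ▸ h)
      omega
    · exact hdent (a - 1) c c hia h (Or.inl rfl)
        ((vert_of_horiz_left L h).resolve_right (hlow _ hia)) (by rwa [sub_add_cancel])

end Hitomezashi

/-- If `i0 + 1/2` is the largest longitude at which a hitomezashi loop
`L` has a horizontal stitch that is an indent or an outdent, then `i0 + 1/2` is an outdent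
longitude of `L`: every horizontal stitch of `L` there is an outdent. -/
theorem hitomezashi_largest_dent_longitude_is_outdent (ε η : ℤ → ZMod 2)
    (L : HLoop ε η) (i0 : ℤ)
    (h1 : ∃ j : ℤ, Stitch.horiz i0 j ∈ L.stitches ∧ (IndentH L i0 j ∨ OutdentH L i0 j))
    (h2 : ∀ i j : ℤ, Stitch.horiz i j ∈ L.stitches →
      (IndentH L i j ∨ OutdentH L i j) → i ≤ i0) :
    ∀ j : ℤ, Stitch.horiz i0 j ∈ L.stitches → OutdentH L i0 j := by
  have hdent : ∀ a b c : ℤ, i0 < a → Stitch.horiz a b ∈ L.stitches → (c = b ∨ c = b - 1) →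
      Stitch.vert a c ∈ L.stitches → Stitch.vert (a + 1) c ∉ L.stitches := by
    intro a b c ha hab hc hv1 hv2
    refine ha.not_ge (h2 a b hab ?_)
    exact (Hitomezashi.cell_subset_extOf_or_intOf (↑L.stitches) a c).imp
      (fun h => ⟨hab, c, hc, hv1, hv2, h⟩) (fun h => ⟨hab, c, hc, hv1, hv2, h⟩)
  obtain ⟨d, hd1, hd2⟩ : ∃ d, Stitch.vert i0 d ∈ L.stitches ∧
      Stitch.vert (i0 + 1) d ∈ L.stitches := by
    obtain ⟨_, _, ⟨_, d, _, hd1, hd2, _⟩ | ⟨_, d, _, hd1, hd2, _⟩⟩ := h1 <;> exact ⟨d, hd1, hd2⟩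
  intro j hj
  obtain ⟨k, hk, hmin⟩ := Hitomezashi.exists_lowest L hj
  have hkup := (Hitomezashi.vert_of_horiz_right L hk).resolve_right
    (Hitomezashi.vert_not_below_lowest L hdent hmin)
  have hkd := Hitomezashi.vert_parity L hkup hd2
  have hk1 : Hitomezashi.crossing L.stitches i0 k = 1 := by
    rw [Hitomezashi.crossing_horiz, if_pos hk, Hitomezashi.crossing_eq_zero, zero_add]
    intro l hl h
    have := hmin l h
    omega
  have hcross := Hitomezashi.crossing_eq_of_same_longitude L hk hj
  rw [hk1] at hcross
  have hl := Hitomezashi.vert_of_horiz_left L hj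
  have hr := Hitomezashi.vert_of_horiz_right L hj
  have hpl : ∀ c, Stitch.vert i0 c ∈ L.stitches → c % 2 = d % 2 :=
    fun c hc => Hitomezashi.vert_parity L hc hd1
  have hpr : ∀ c, Stitch.vert (i0 + 1) c ∈ L.stitches → c % 2 = d % 2 :=
    fun c hc => Hitomezashi.vert_parity L hc hd2
  by_cases hjk : k % 2 = j % 2
  · rw [if_pos hjk] at hcross
    refine ⟨hj, j, Or.inl rfl, hl.resolve_right fun h => ?_, hr.resolve_right fun h => ?_,
      Hitomezashi.cell_subset_intOf L (hcross ▸ one_ne_zero)⟩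
    · have := hpl _ h
      omega
    · have := hpr _ h
      omega
  · rw [if_neg hjk] at hcross
    refine ⟨hj, j - 1, Or.inr rfl, hl.resolve_left fun h => ?_, hr.resolve_left fun h => ?_,
      Hitomezashi.cell_subset_intOf L (hcross ▸ one_ne_zero)⟩
    · have := hpl _ h
      omega
    · have := hpr _ h
      omega
end

section
/- Suppose a splice at longitude i0 merges an agreeable pseudo-hitomezashi loop L with a pseudo-hitomezashi strand S, producing a single pseudo-hitomezashi strand L'. Then both S and L' are contained in the union of L with its interior, and L' is an agreeable pseudo-hitomezashi loop. -/
/-- The set of stitches of the hitomezashi pattern with labels `ε`, `η`. -/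
def patternSet (ε η : ℤ → ZMod 2) : Set Stitch := {s | s.InPattern ε η}

/-- A local move at longitude `k + 1/2`: the two vertical stitches `vert k j` and
`vert (k+1) j` are replaced by the two horizontal stitches `horiz k j` and `horiz k (j+1)`;
it may be applied only when those horizontal stitches are absent. -/
def LocalMoveAt (k : ℤ) (S T : Set Stitch) : Prop :=
  ∃ j : ℤ, Stitch.vert k j ∈ S ∧ Stitch.vert (k+1) j ∈ S ∧
    Stitch.horiz k j ∉ S ∧ Stitch.horiz k (j+1) ∉ S ∧
    T = (S \ {Stitch.vert k j, Stitch.vert (k+1) j}) ∪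
      {Stitch.horiz k j, Stitch.horiz k (j+1)}

/-- A square deletion at longitude `k + 1/2`: all four stitches of a unit square
centered at longitude `k + 1/2` are deleted. -/
def SquareDeletionAt (k : ℤ) (S T : Set Stitch) : Prop :=
  ∃ j : ℤ, Stitch.vert k j ∈ S ∧ Stitch.vert (k+1) j ∈ S ∧
    Stitch.horiz k j ∈ S ∧ Stitch.horiz k (j+1) ∈ S ∧
    T = S \ {Stitch.vert k j, Stitch.vert (k+1) j, Stitch.horiz k j, Stitch.horiz k (j+1)}

/-- `S` is a pseudo-hitomezashi pattern with respect to longitude `k + 1/2`: it is obtained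
from the hitomezashi pattern with labels `ε`, `η` by applying finitely many local moves and
square deletions at longitude `k + 1/2`. -/
def IsPseudoPattern (ε η : ℤ → ZMod 2) (k : ℤ) (S : Set Stitch) : Prop :=
  Relation.ReflTransGen (fun A B => LocalMoveAt k A B ∨ SquareDeletionAt k A B)
    (patternSet ε η) S

/-- A loop `C` (oriented counterclockwise, interior on the left) is agreeable for
longitude `k + 1/2`: its vertical stitches at longitude `k` are all oriented north-to-south
and those at longitude `k+1` are all oriented south-to-north; equivalently, the unit cell
between longitudes `k` and `k+1` adjacent to any such stitch lies in the interior of `C`. -/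
def AgreeableAt (k : ℤ) (C : Set (ℝ × ℝ)) : Prop :=
  ∀ j : ℤ, ((Stitch.vert k j).seg ⊆ C ∨ (Stitch.vert (k+1) j).seg ⊆ C) → cell k j ⊆ intOf C

/-- `σ` moves every lattice point by at most one unit step and never backtracks. -/
structure IsLatticeFlow (σ : Equiv.Perm (ℤ × ℤ)) : Prop where
  adj : ∀ x y : ℤ, σ (x, y) = (x, y) ∨ σ (x, y) = (x + 1, y) ∨ σ (x, y) = (x - 1, y) ∨
    σ (x, y) = (x, y + 1) ∨ σ (x, y) = (x, y - 1)
  noBack : ∀ v, σ (σ v) = v → σ v = v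

/-- The stitches joining a point `v ∈ O` to `σ v`. -/
def edgeSet (σ : Equiv.Perm (ℤ × ℤ)) (O : Set (ℤ × ℤ)) : Set Stitch := {s | match s with
  | .vert i j => ((i, j) ∈ O ∧ σ (i, j) = (i, j + 1)) ∨ ((i, j + 1) ∈ O ∧ σ (i, j + 1) = (i, j))
  | .horiz i j =>
    ((i, j) ∈ O ∧ σ (i, j) = (i + 1, j)) ∨ ((i + 1, j) ∈ O ∧ σ (i + 1, j) = (i, j))}

theorem vert_mem_edgeSet {σ : Equiv.Perm (ℤ × ℤ)} {O : Set (ℤ × ℤ)} {i j : ℤ} :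
    Stitch.vert i j ∈ edgeSet σ O ↔
      ((i, j) ∈ O ∧ σ (i, j) = (i, j + 1)) ∨ ((i, j + 1) ∈ O ∧ σ (i, j + 1) = (i, j)) :=
  Iff.rfl

theorem horiz_mem_edgeSet {σ : Equiv.Perm (ℤ × ℤ)} {O : Set (ℤ × ℤ)} {i j : ℤ} :
    Stitch.horiz i j ∈ edgeSet σ O ↔
      ((i, j) ∈ O ∧ σ (i, j) = (i + 1, j)) ∨ ((i + 1, j) ∈ O ∧ σ (i + 1, j) = (i, j)) :=
  Iff.rfl

/-- `σ` is a lattice flow whose stitches form `S`, going south along longitude `k`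
and north along longitude `k + 1`. -/
structure Orients (k : ℤ) (σ : Equiv.Perm (ℤ × ℤ)) (S : Set Stitch) : Prop where
  flow : IsLatticeFlow σ
  edges : S = edgeSet σ Set.univ
  south : ∀ i, σ (k, i) ≠ (k, i + 1)
  north : ∀ i, σ (k + 1, i + 1) ≠ (k + 1, i)

theorem Orients.vert_left {k : ℤ} {σ : Equiv.Perm (ℤ × ℤ)} {S : Set Stitch} (h : Orients k σ S)
    {j : ℤ} (hj : Stitch.vert k j ∈ S) : σ (k, j + 1) = (k, j) := by
  have := h.south j
  rw [h.edges, vert_mem_edgeSet] at hj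
  simpa [this] using hj

theorem Orients.vert_right {k : ℤ} {σ : Equiv.Perm (ℤ × ℤ)} {S : Set Stitch} (h : Orients k σ S)
    {j : ℤ} (hj : Stitch.vert (k + 1) j ∈ S) : σ (k + 1, j) = (k + 1, j + 1) := by
  have := h.north j
  rw [h.edges, vert_mem_edgeSet] at hj
  simpa [this] using hj

theorem Orients.localMove {k j : ℤ} {σ : Equiv.Perm (ℤ × ℤ)} {S : Set Stitch} (h : Orients k σ S)
    (hv1 : Stitch.vert k j ∈ S) (hv2 : Stitch.vert (k + 1) j ∈ S)
    (hh1 : Stitch.horiz k j ∉ S) (hh2 : Stitch.horiz k (j + 1) ∉ S) :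
    Orients k (σ * Equiv.swap (k, j + 1) (k + 1, j))
      ((S \ {Stitch.vert k j, Stitch.vert (k + 1) j}) ∪
        {Stitch.horiz k j, Stitch.horiz k (j + 1)}) := by
  have ha := h.vert_left hv1
  have hb := h.vert_right hv2
  have key : ∀ v, (σ * Equiv.swap (k, j + 1) (k + 1, j)) v =
      if v = (k, j + 1) then (k + 1, j + 1) else if v = (k + 1, j) then (k, j) else σ v := by
    intro v
    rw [Equiv.Perm.mul_apply]
    split_ifs with h1 h2
    · rw [h1, Equiv.swap_apply_left, hb]
    · rw [h2, Equiv.swap_apply_right, ha]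
    · rw [Equiv.swap_apply_of_ne_of_ne h1 h2]
  have inj : ∀ v w, σ v = σ w → v = w := fun v w hvw => σ.injective hvw
  rw [h.edges, horiz_mem_edgeSet] at hh1 hh2
  simp only [Set.mem_univ, true_and, not_or] at hh1 hh2
  generalize (σ * Equiv.swap (k, j + 1) (k + 1, j)) = τ at key
  refine ⟨⟨?_, ?_⟩, ?_, ?_, ?_⟩
  · intro x y
    rw [key]
    have := h.flow.adj x y
    split_ifs with h1 h2
    · grind
    · grind
    · exact this
  · intro v
    have := h.flow.noBack v
    rw [key, key]
    split_ifs <;> grind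
  · ext s
    cases s with
    | vert x y =>
      have hs := h.south
      have hn := h.north
      have h1 := h.flow.noBack (x, y)
      have h2 := h.flow.noBack (x, y + 1)
      simp only [h.edges, vert_mem_edgeSet, key, Set.mem_union, Set.mem_sdiff, Set.mem_insert_iff,
        Set.mem_singleton_iff, Stitch.vert.injEq, reduceCtorEq, Set.mem_univ, true_and, or_false,
        Prod.mk.injEq]
      grind
    | horiz x y =>
      have h1 := h.flow.noBack (x, y)
      have h2 := h.flow.noBack (x + 1, y)
      simp only [h.edges, horiz_mem_edgeSet, key, Set.mem_union, Set.mem_sdiff, Set.mem_insert_iff,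
        Set.mem_singleton_iff, Stitch.horiz.injEq, reduceCtorEq, Set.mem_univ, true_and, or_false,
        Prod.mk.injEq]
      grind
  · intro i
    have := h.south i
    rw [key]
    split_ifs <;> grind
  · intro i
    have := h.north i
    rw [key]
    split_ifs <;> grind

theorem Orients.squareDeletion {k j : ℤ} {σ : Equiv.Perm (ℤ × ℤ)} {S : Set Stitch}
    (h : Orients k σ S)
    (hv1 : Stitch.vert k j ∈ S) (hv2 : Stitch.vert (k + 1) j ∈ S)
    (hh1 : Stitch.horiz k j ∈ S) (hh2 : Stitch.horiz k (j + 1) ∈ S) :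
    ∃ τ, Orients k τ (S \ {Stitch.vert k j, Stitch.vert (k + 1) j, Stitch.horiz k j,
      Stitch.horiz k (j + 1)}) := by
  have ha := h.vert_left hv1
  have hb := h.vert_right hv2
  have inj : ∀ v w, σ v = σ w → v = w := fun v w hvw => σ.injective hvw
  rw [h.edges, horiz_mem_edgeSet] at hh1 hh2
  simp only [Set.mem_univ, true_and, hb] at hh1 hh2
  have hc : σ (k, j) = (k + 1, j) := by grind
  have hd : σ (k + 1, j + 1) = (k, j + 1) := by grind
  let p : ℤ × ℤ → Prop := fun v => ¬ (v = (k, j) ∨ v = (k + 1, j) ∨ v = (k, j + 1) ∨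
    v = (k + 1, j + 1))
  have hp : ∀ v, p (σ v) ↔ p v := by
    intro v
    simp only [p]
    grind
  classical
  obtain ⟨τ, key⟩ : ∃ τ : Equiv.Perm (ℤ × ℤ), ∀ v, τ v =
      if v = (k, j) ∨ v = (k + 1, j) ∨ v = (k, j + 1) ∨ v = (k + 1, j + 1) then v else σ v := by
    refine ⟨Equiv.Perm.ofSubtype (σ.subtypePerm hp), fun v => ?_⟩
    split_ifs with hv
    · exact Equiv.Perm.ofSubtype_apply_of_not_mem _ (not_not.2 hv)
    · rw [Equiv.Perm.ofSubtype_apply_of_mem _ (show p v from hv)]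
      rfl
  refine ⟨τ, ⟨?_, ?_⟩, ?_, ?_, ?_⟩
  · intro x y
    rw [key]
    split_ifs
    · exact Or.inl rfl
    · exact h.flow.adj x y
  · intro v
    have := h.flow.noBack v
    rw [key, key]
    split_ifs <;> grind
  · ext s
    cases s with
    | vert x y =>
      have h1 := h.flow.noBack (x, y)
      have h2 := h.flow.noBack (x, y + 1)
      simp only [h.edges, vert_mem_edgeSet, key, Set.mem_sdiff, Set.mem_insert_iff,
        Set.mem_singleton_iff, Stitch.vert.injEq, reduceCtorEq, Set.mem_univ, true_and, or_false]
      split_ifs <;> grind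
    | horiz x y =>
      have h1 := h.flow.noBack (x, y)
      have h2 := h.flow.noBack (x + 1, y)
      simp only [h.edges, horiz_mem_edgeSet, key, Set.mem_sdiff, Set.mem_insert_iff,
        Set.mem_singleton_iff, Stitch.horiz.injEq, reduceCtorEq, Set.mem_univ, true_and, false_or]
      split_ifs <;> grind
  · intro i
    have := h.south i
    rw [key]
    split_ifs <;> grind
  · intro i
    have := h.north i
    rw [key]
    split_ifs <;> grind

/-- A flow alternating between vertical and horizontal steps: `E x y` says that the vertical
stitch at `(x, y)` goes up, `F x y` that the horizontal one goes right, and `P x y` that the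
flow leaves `(x, y)` vertically. -/
theorem exists_perm_of_checkerboard (E F P : ℤ → ℤ → Prop)
    (hE : ∀ x y, E x (y + 1) ↔ ¬ E x y) (hF : ∀ x y, F (x + 1) y ↔ ¬ F x y)
    (hP1 : ∀ x y, P x (y + 1) ↔ ¬ P x y) (hP2 : ∀ x y, P (x + 1) y ↔ ¬ P x y) :
    ∃ σ : Equiv.Perm (ℤ × ℤ), ∀ x y,
      (P x y → E x y → σ (x, y) = (x, y + 1)) ∧ (P x y → ¬ E x y → σ (x, y) = (x, y - 1)) ∧
      (¬ P x y → F x y → σ (x, y) = (x + 1, y)) ∧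
      (¬ P x y → ¬ F x y → σ (x, y) = (x - 1, y)) := by
  classical
  have hE' : ∀ x y, E x (y - 1) ↔ ¬ E x y := fun x y => by
    have := hE x (y - 1); rw [sub_add_cancel] at this; tauto
  have hF' : ∀ x y, F (x - 1) y ↔ ¬ F x y := fun x y => by
    have := hF (x - 1) y; rw [sub_add_cancel] at this; tauto
  have hP1' : ∀ x y, P x (y - 1) ↔ ¬ P x y := fun x y => by
    have := hP1 x (y - 1); rw [sub_add_cancel] at this; tauto
  have hP2' : ∀ x y, P (x - 1) y ↔ ¬ P x y := fun x y => by
    have := hP2 (x - 1) y; rw [sub_add_cancel] at this; tauto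
  let V : ℤ × ℤ → ℤ × ℤ := fun v => if E v.1 v.2 then (v.1, v.2 + 1) else (v.1, v.2 - 1)
  let H : ℤ × ℤ → ℤ × ℤ := fun v => if F v.1 v.2 then (v.1 + 1, v.2) else (v.1 - 1, v.2)
  refine ⟨⟨fun v => if P v.1 v.2 then V v else H v, fun v => if P v.1 v.2 then H v else V v,
    ?_, ?_⟩, ?_⟩
  · rintro ⟨x, y⟩
    simp only [V, H]
    by_cases hp : P x y <;> by_cases he : E x y <;> by_cases hf : F x y <;> simp [*]
  · rintro ⟨x, y⟩
    simp only [V, H]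
    by_cases hp : P x y <;> by_cases he : E x y <;> by_cases hf : F x y <;> simp [*]
  · intro x y
    simp only [Equiv.coe_fn_mk, V, H]
    by_cases hp : P x y <;> by_cases he : E x y <;> by_cases hf : F x y <;> simp [*]

theorem orients_patternSet {ε η : ℤ → ZMod 2} {k : ℤ} (hk : ε k = ε (k + 1)) :
    ∃ σ, Orients k σ (patternSet ε η) := by
  have flip : ∀ a b : ZMod 2, a + 1 = b ↔ ¬ a = b := by decide
  have flip' : ∀ a b c : ZMod 2, a + 1 + b = c ↔ ¬ a + b = c := by decide
  have flip'' : ∀ a b c : ZMod 2, a + (b + 1) = c ↔ ¬ a + b = c := by decide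
  let E : ℤ → ℤ → Prop := fun x y => (y : ZMod 2) = ε x
  let F : ℤ → ℤ → Prop := fun x y => (x : ZMod 2) = η y
  let P : ℤ → ℤ → Prop := fun x y => (x : ZMod 2) + (y : ZMod 2) = (k : ZMod 2) + ε k + 1
  have hE : ∀ x y, E x (y + 1) ↔ ¬ E x y := fun x y => by
    simp only [E]; push_cast; exact flip _ _
  have hF : ∀ x y, F (x + 1) y ↔ ¬ F x y := fun x y => by
    simp only [F]; push_cast; exact flip _ _
  have hP1 : ∀ x y, P x (y + 1) ↔ ¬ P x y := fun x y => by
    simp only [P]; push_cast; exact flip'' _ _ _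
  have hP2 : ∀ x y, P (x + 1) y ↔ ¬ P x y := fun x y => by
    simp only [P]; push_cast; exact flip' _ _ _
  have hs : ∀ i, E k i → ¬ P k i := by
    intro i hi
    simp only [E] at hi
    simp only [P, hi]
    generalize (k : ZMod 2) + ε k = a
    revert a; decide
  have hn : ∀ i, E (k + 1) i → P (k + 1) i := by
    intro i hi
    simp only [E] at hi
    simp only [P, hi, ← hk]
    push_cast
    ring
  have hmem : ∀ s, s ∈ patternSet ε η ↔ match s with
      | .vert x y => E x y
      | .horiz x y => F x y := by
    rintro (_ | _) <;> rfl
  clear_value E F P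
  obtain ⟨σ, hσ⟩ := exists_perm_of_checkerboard E F P hE hF hP1 hP2
  refine ⟨σ, ⟨?_, ?_⟩, ?_, ?_, ?_⟩
  · intro x y
    have := hσ x y
    tauto
  · rintro ⟨x, y⟩ h
    exfalso
    have horiz : ∀ x y, ¬ P x y → (σ (x, y)).2 = y := fun x y hp => by
      by_cases hf : F x y
      · rw [(hσ x y).2.2.1 hp hf]
      · rw [(hσ x y).2.2.2 hp hf]
    have vert : ∀ x y, P x y → (σ (x, y)).1 = x := fun x y hp => by
      by_cases he : E x y
      · rw [(hσ x y).1 hp he]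
      · rw [(hσ x y).2.1 hp he]
    by_cases hp : P x y
    · by_cases he : E x y
      · rw [(hσ x y).1 hp he] at h
        have := horiz x (y + 1) (by rwa [hP1, not_not])
        simp [h] at this
      · rw [(hσ x y).2.1 hp he] at h
        have := horiz x (y - 1) (by
          have := hP1 x (y - 1)
          rw [sub_add_cancel] at this
          tauto)
        rw [h] at this
        dsimp only at this
        omega
    · by_cases he : F x y
      · rw [(hσ x y).2.2.1 hp he] at h
        have := vert (x + 1) y (by rwa [hP2])
        simp [h] at this
      · rw [(hσ x y).2.2.2 hp he] at h
        have := vert (x - 1) y (by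
          have := hP2 (x - 1) y
          rw [sub_add_cancel] at this
          tauto)
        rw [h] at this
        dsimp only at this
        omega
  · ext s
    rw [hmem]
    cases s with
    | vert x y =>
      rw [vert_mem_edgeSet]
      have h1 := hσ x y
      have h2 := hσ x (y + 1)
      have := hP1 x y
      have := hE x y
      simp only [Set.mem_univ, true_and]
      grind
    | horiz x y =>
      rw [horiz_mem_edgeSet]
      have h1 := hσ x y
      have h2 := hσ (x + 1) y
      have := hP2 x y
      have := hF x y
      simp only [Set.mem_univ, true_and]
      grind
  · intro i h
    have h1 := hσ k i
    have := hs i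
    grind
  · intro i h
    have h1 := hσ (k + 1) (i + 1)
    have := hn i
    have := hE (k + 1) i
    have := hP1 (k + 1) i
    grind

theorem IsPseudoPattern.exists_orients {ε η : ℤ → ZMod 2} {k : ℤ} (hk : ε k = ε (k + 1))
    {S : Set Stitch} (hS : IsPseudoPattern ε η k S) : ∃ σ, Orients k σ S := by
  induction hS with
  | refl => exact orients_patternSet hk
  | tail _ hstep ih =>
    obtain ⟨σ, hσ⟩ := ih
    rcases hstep with ⟨j, h1, h2, h3, h4, rfl⟩ | ⟨j, h1, h2, h3, h4, rfl⟩
    · exact ⟨_, hσ.localMove h1 h2 h3 h4⟩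
    · exact hσ.squareDeletion h1 h2 h3 h4

theorem mem_seg_vert {i j : ℤ} {p : ℝ × ℝ} :
    p ∈ (Stitch.vert i j).seg ↔ p.1 = i ∧ (j : ℝ) ≤ p.2 ∧ p.2 ≤ j + 1 := by
  obtain ⟨x, y⟩ := p
  simp only [Stitch.seg, segment_eq_image, Set.mem_image, Set.mem_Icc, Prod.smul_mk, Prod.mk_add_mk,
    Prod.mk.injEq, smul_eq_mul]
  constructor
  · rintro ⟨t, ⟨h0, h1⟩, rfl, rfl⟩
    exact ⟨by ring, by linarith, by linarith⟩
  · rintro ⟨rfl, h0, h1⟩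
    exact ⟨y - j, ⟨by linarith, by linarith⟩, by ring, by ring⟩

theorem mem_seg_horiz {i j : ℤ} {p : ℝ × ℝ} :
    p ∈ (Stitch.horiz i j).seg ↔ ((i : ℝ) ≤ p.1 ∧ p.1 ≤ i + 1) ∧ p.2 = j := by
  obtain ⟨x, y⟩ := p
  simp only [Stitch.seg, segment_eq_image, Set.mem_image, Set.mem_Icc, Prod.smul_mk, Prod.mk_add_mk,
    Prod.mk.injEq, smul_eq_mul]
  constructor
  · rintro ⟨t, ⟨h0, h1⟩, rfl, rfl⟩
    exact ⟨⟨by linarith, by linarith⟩, by ring⟩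
  · rintro ⟨⟨h0, h1⟩, rfl⟩
    exact ⟨x - i, ⟨by linarith, by linarith⟩, by ring, by ring⟩

theorem mem_curveOf {S : Set Stitch} {p : ℝ × ℝ} : p ∈ curveOf S ↔ ∃ s ∈ S, p ∈ s.seg := by
  simp [curveOf]

theorem curveOf_mono {S T : Set Stitch} (h : S ⊆ T) : curveOf S ⊆ curveOf T :=
  Set.biUnion_subset_biUnion_left h

/-- The midpoint of a stitch. -/
noncomputable def Stitch.mid : Stitch → ℝ × ℝ
  | .vert i j => ((i : ℝ), (j : ℝ) + 1 / 2)
  | .horiz i j => ((i : ℝ) + 1 / 2, (j : ℝ))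

theorem Stitch.mid_mem_seg (s : Stitch) : s.mid ∈ s.seg := by
  cases s
  · rw [mem_seg_vert]; simp only [Stitch.mid]; refine ⟨trivial, ?_, ?_⟩ <;> linarith
  · rw [mem_seg_horiz]; simp only [Stitch.mid]; refine ⟨⟨?_, ?_⟩, trivial⟩ <;> linarith

theorem int_ne_add_half (a b : ℤ) : (a : ℝ) + 1 / 2 ≠ b := by
  intro h
  have : (2 * a + 1 : ℝ) = 2 * b := by linarith
  norm_cast at this
  omega

theorem int_eq_of_half_mem {a b : ℤ} (h1 : (a : ℝ) ≤ b + 1 / 2) (h2 : (b : ℝ) + 1 / 2 ≤ a + 1) :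
    a = b := by
  have h1' : (2 * a : ℝ) ≤ 2 * b + 1 := by linarith
  have h2' : (2 * b + 1 : ℝ) ≤ 2 * a + 2 := by linarith
  norm_cast at h1' h2'
  omega

theorem Stitch.eq_of_mid_mem_seg {s t : Stitch} (h : s.mid ∈ t.seg) : s = t := by
  rcases s with ⟨i, j⟩ | ⟨i, j⟩ <;> rcases t with ⟨a, b⟩ | ⟨a, b⟩ <;>
    simp only [mem_seg_vert, mem_seg_horiz, Stitch.mid] at h
  · obtain ⟨h1, h2, h3⟩ := h
    rw [Int.cast_injective h1, int_eq_of_half_mem h2 h3]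
  · exact absurd h.2 (int_ne_add_half _ _)
  · exact absurd h.1 (int_ne_add_half _ _)
  · obtain ⟨⟨h2, h3⟩, h1⟩ := h
    rw [Int.cast_injective h1, int_eq_of_half_mem h2 h3]

theorem mid_mem_curveOf {S : Set Stitch} {s : Stitch} : s.mid ∈ curveOf S ↔ s ∈ S := by
  rw [mem_curveOf]
  refine ⟨?_, fun h => ⟨s, h, s.mid_mem_seg⟩⟩
  rintro ⟨t, ht, hs⟩
  rwa [Stitch.eq_of_mid_mem_seg hs]

/-- The closed unit cell with southwest corner `c`. -/
def closedCell (c : ℤ × ℤ) : Set (ℝ × ℝ) :=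
  Set.Icc (c.1 : ℝ) (c.1 + 1) ×ˢ Set.Icc (c.2 : ℝ) (c.2 + 1)

theorem mem_closedCell {a b : ℤ} {p : ℝ × ℝ} : p ∈ closedCell (a, b) ↔
    ((a : ℝ) ≤ p.1 ∧ p.1 ≤ a + 1) ∧ (b : ℝ) ≤ p.2 ∧ p.2 ≤ b + 1 := Iff.rfl

theorem isClosed_closedCell (c : ℤ × ℤ) : IsClosed (closedCell c) :=
  isClosed_Icc.prod isClosed_Icc

theorem closure_cell (a b : ℤ) : closure (cell a b) = closedCell (a, b) := by
  rw [cell, closure_prod_eq, closure_Ioo (by simp), closure_Ioo (by simp)]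
  rfl

theorem exists_mem_closedCell (p : ℝ × ℝ) : ∃ c, p ∈ closedCell c :=
  ⟨(⌊p.1⌋, ⌊p.2⌋), ⟨Int.floor_le _, (Int.lt_floor_add_one _).le⟩,
    ⟨Int.floor_le _, (Int.lt_floor_add_one _).le⟩⟩

theorem locallyFinite_Icc_int : LocallyFinite fun n : ℤ => Set.Icc (n : ℝ) (n + 1) := by
  intro x
  refine ⟨Set.Ioo (x - 1) (x + 1), Ioo_mem_nhds (by linarith) (by linarith), ?_⟩
  refine (Set.finite_Icc (⌊x⌋ - 3) (⌊x⌋ + 3)).subset ?_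
  rintro n ⟨y, ⟨h1, h2⟩, h3, h4⟩
  have := Int.floor_le x
  have := Int.lt_floor_add_one x
  constructor
  · have : ((⌊x⌋ - 3 : ℤ) : ℝ) ≤ n := by push_cast; linarith
    exact_mod_cast this
  · have : (n : ℝ) ≤ ((⌊x⌋ + 3 : ℤ) : ℝ) := by push_cast; linarith
    exact_mod_cast this

theorem locallyFinite_closedCell : LocallyFinite closedCell := by
  intro p
  obtain ⟨u, hu, hu'⟩ := locallyFinite_Icc_int p.1
  obtain ⟨v, hv, hv'⟩ := locallyFinite_Icc_int p.2
  refine ⟨u ×ˢ v, prod_mem_nhds hu hv, (hu'.prod hv').subset ?_⟩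
  rintro c ⟨q, hq, hq'⟩
  exact ⟨⟨q.1, hq.1, hq'.1⟩, ⟨q.2, hq.2, hq'.2⟩⟩

theorem isClosed_biUnion_closedCell (T : Set (ℤ × ℤ)) : IsClosed (⋃ c ∈ T, closedCell c) :=
  (locallyFinite_closedCell.subset fun _ => Set.iUnion_subset fun _ => le_rfl).isClosed_iUnion
    fun c => isClosed_iUnion_of_finite fun _ => isClosed_closedCell c

theorem isClosed_seg (s : Stitch) : IsClosed s.seg := by
  rcases s with ⟨i, j⟩ | ⟨i, j⟩
  · have : (Stitch.vert i j).seg = {(i : ℝ)} ×ˢ Set.Icc (j : ℝ) (j + 1) := by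
      ext p; rw [mem_seg_vert]; rfl
    rw [this]
    exact isClosed_singleton.prod isClosed_Icc
  · have : (Stitch.horiz i j).seg = Set.Icc (i : ℝ) (i + 1) ×ˢ {(j : ℝ)} := by
      ext p; rw [mem_seg_horiz]; rfl
    rw [this]
    exact isClosed_Icc.prod isClosed_singleton

theorem isClosed_curveOf (S : Set Stitch) : IsClosed (curveOf S) := by
  have h1 : IsClosed (⋃ c : ℤ × ℤ, ⋃ _ : Stitch.vert c.1 c.2 ∈ S, (Stitch.vert c.1 c.2).seg) := by
    refine (locallyFinite_closedCell.subset fun c => Set.iUnion_subset fun _ => ?_).isClosed_iUnion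
      fun c => isClosed_iUnion_of_finite fun _ => isClosed_seg _
    intro p hp
    rw [mem_seg_vert] at hp
    exact ⟨⟨hp.1.ge, by linarith [hp.1]⟩, hp.2⟩
  have h2 : IsClosed (⋃ c : ℤ × ℤ, ⋃ _ : Stitch.horiz c.1 c.2 ∈ S, (Stitch.horiz c.1 c.2).seg) := by
    refine (locallyFinite_closedCell.subset fun c => Set.iUnion_subset fun _ => ?_).isClosed_iUnion
      fun c => isClosed_iUnion_of_finite fun _ => isClosed_seg _
    intro p hp
    rw [mem_seg_horiz] at hp
    exact ⟨hp.1, hp.2.ge, by linarith [hp.2]⟩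
  convert h1.union h2 using 1
  ext p
  simp only [mem_curveOf, Set.mem_union, Set.mem_iUnion, exists_prop, Prod.exists]
  constructor
  · rintro ⟨⟨i, j⟩ | ⟨i, j⟩, hs, hp⟩
    · exact Or.inl ⟨i, j, hs, hp⟩
    · exact Or.inr ⟨i, j, hs, hp⟩
  · rintro (⟨i, j, hs, hp⟩ | ⟨i, j, hs, hp⟩)
    · exact ⟨_, hs, hp⟩
    · exact ⟨_, hs, hp⟩

/-- The point at time `f` of the segment traversed from `v` to `σ v`. -/
noncomputable def edgePoint (σ : Equiv.Perm (ℤ × ℤ)) (v : ℤ × ℤ) (f : ℝ) : ℝ × ℝ :=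
  ((v.1 : ℝ) + f * (((σ v).1 : ℝ) - v.1), (v.2 : ℝ) + f * (((σ v).2 : ℝ) - v.2))

theorem edgePoint_one (σ : Equiv.Perm (ℤ × ℤ)) (v : ℤ × ℤ) :
    edgePoint σ v 1 = edgePoint σ (σ v) 0 := by
  simp [edgePoint]

theorem IsLatticeFlow.mem_curveOf_edgeSet {σ : Equiv.Perm (ℤ × ℤ)} (hσ : IsLatticeFlow σ)
    {O : Set (ℤ × ℤ)} {p : ℝ × ℝ} : p ∈ curveOf (edgeSet σ O) ↔
      ∃ v ∈ O, σ v ≠ v ∧ ∃ f : ℝ, 0 ≤ f ∧ f ≤ 1 ∧ p = edgePoint σ v f := by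
  rw [mem_curveOf]
  obtain ⟨x, y⟩ := p
  constructor
  · rintro ⟨⟨i, j⟩ | ⟨i, j⟩, hs, hp⟩
    · rw [mem_seg_vert] at hp
      obtain ⟨rfl : x = i, h1 : (j : ℝ) ≤ y, h2 : y ≤ j + 1⟩ := hp
      rcases vert_mem_edgeSet.1 hs with ⟨hO, h⟩ | ⟨hO, h⟩
      · refine ⟨_, hO, by simp [h], y - j, by linarith, by linarith, ?_⟩
        simp [edgePoint, h]
      · refine ⟨_, hO, by simp [h], j + 1 - y, by linarith, by linarith, ?_⟩
        simp [edgePoint, h]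
    · rw [mem_seg_horiz] at hp
      obtain ⟨⟨h1 : (i : ℝ) ≤ x, h2 : x ≤ i + 1⟩, rfl : y = j⟩ := hp
      rcases horiz_mem_edgeSet.1 hs with ⟨hO, h⟩ | ⟨hO, h⟩
      · refine ⟨_, hO, by simp [h], x - i, by linarith, by linarith, ?_⟩
        simp [edgePoint, h]
      · refine ⟨_, hO, by simp [h], i + 1 - x, by linarith, by linarith, ?_⟩
        simp [edgePoint, h]
  · rintro ⟨⟨i, j⟩, hO, hne, f, h0, h1, hp⟩
    rw [hp]
    rcases hσ.adj i j with h | h | h | h | h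
    · exact absurd h hne
    · refine ⟨.horiz i j, horiz_mem_edgeSet.2 (Or.inl ⟨hO, h⟩), mem_seg_horiz.2 ?_⟩
      simp [edgePoint, h, h0, h1]
    · refine ⟨.horiz (i - 1) j, horiz_mem_edgeSet.2 (Or.inr (by simp [hO, h])), mem_seg_horiz.2 ?_⟩
      simp only [edgePoint, h]
      push_cast
      exact ⟨⟨by linarith, by linarith⟩, by ring⟩
    · refine ⟨.vert i j, vert_mem_edgeSet.2 (Or.inl ⟨hO, h⟩), mem_seg_vert.2 ?_⟩
      simp [edgePoint, h, h0, h1]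
    · refine ⟨.vert i (j - 1), vert_mem_edgeSet.2 (Or.inr (by simp [hO, h])), mem_seg_vert.2 ?_⟩
      simp only [edgePoint, h]
      push_cast
      exact ⟨by ring, by linarith, by linarith⟩

theorem IsLatticeFlow.mem_curveOf_edgeSet_Ico {σ : Equiv.Perm (ℤ × ℤ)} (hσ : IsLatticeFlow σ)
    {O : Set (ℤ × ℤ)} (hO : ∀ v ∈ O, σ v ∈ O) {p : ℝ × ℝ} : p ∈ curveOf (edgeSet σ O) ↔
      ∃ v ∈ O, σ v ≠ v ∧ ∃ f : ℝ, 0 ≤ f ∧ f < 1 ∧ p = edgePoint σ v f := by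
  rw [hσ.mem_curveOf_edgeSet]
  constructor
  · rintro ⟨v, hv, hne, f, h0, h1, rfl⟩
    rcases h1.lt_or_eq with h1 | rfl
    · exact ⟨v, hv, hne, f, h0, h1, rfl⟩
    · exact ⟨σ v, hO v hv, fun h => hne (σ.injective h), 0, le_rfl, one_pos, edgePoint_one σ v⟩
  · rintro ⟨v, hv, hne, f, h0, h1, rfl⟩
    exact ⟨v, hv, hne, f, h0, h1.le, rfl⟩

theorem int_add_fract_inj {a b : ℤ} {f g : ℝ} (hf0 : 0 ≤ f) (hf1 : f < 1) (hg0 : 0 ≤ g)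
    (hg1 : g < 1) (h : (a : ℝ) + f = b + g) : a = b ∧ f = g := by
  have hab : a = b := by
    have h1 : (a : ℝ) < b + 1 := by linarith
    have h2 : (b : ℝ) < a + 1 := by linarith
    norm_cast at h1 h2
    omega
  subst hab
  exact ⟨rfl, by linarith⟩

theorem int_add_fract_eq_sub {a b : ℤ} {f g : ℝ} (hf0 : 0 ≤ f) (hf1 : f < 1) (hg0 : 0 ≤ g)
    (hg1 : g < 1) (h : (a : ℝ) + f = b - g) : (a = b ∧ f = g) ∨ b = a + 1 := by
  have h1 : (a : ℝ) < b + 1 := by linarith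
  have h2 : (b : ℝ) < a + 2 := by linarith
  norm_cast at h1 h2
  rcases (by omega : a = b ∨ b = a + 1) with rfl | h
  · exact Or.inl ⟨rfl, by linarith⟩
  · exact Or.inr h

theorem IsLatticeFlow.edgePoint_inj {σ : Equiv.Perm (ℤ × ℤ)} (hσ : IsLatticeFlow σ)
    {v w : ℤ × ℤ} {f g : ℝ} (hv : σ v ≠ v) (hw : σ w ≠ w) (hf0 : 0 ≤ f) (hf1 : f < 1)
    (hg0 : 0 ≤ g) (hg1 : g < 1) (h : edgePoint σ v f = edgePoint σ w g) : v = w ∧ f = g := by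
  obtain ⟨x, y⟩ := v
  obtain ⟨x', y'⟩ := w
  have hbv := hσ.noBack (x, y)
  have hbw := hσ.noBack (x', y')
  have A : ∀ {a b : ℤ}, (a : ℝ) + f = b + g → a = b ∧ f = g :=
    int_add_fract_inj hf0 hf1 hg0 hg1
  have A' : ∀ {a b : ℤ}, (a : ℝ) - f = b - g → a = b ∧ f = g := fun {a b} h => by
    have := int_add_fract_inj hf0 hf1 hg0 hg1 (a := -a) (b := -b) (by push_cast; linarith)
    exact ⟨by omega, this.2⟩
  have B : ∀ {a b : ℤ}, (a : ℝ) + f = b - g → (a = b ∧ f = g) ∨ b = a + 1 :=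
    int_add_fract_eq_sub hf0 hf1 hg0 hg1
  have B' : ∀ {a b : ℤ}, (a : ℝ) - f = b + g → (a = b ∧ f = g) ∨ a = b + 1 := fun {a b} h => by
    have := int_add_fract_eq_sub hg0 hg1 hf0 hf1 h.symm
    rcases this with h | h
    · exact Or.inl ⟨h.1.symm, h.2.symm⟩
    · exact Or.inr h
  have F : ∀ {a b : ℤ}, (a : ℝ) + f = b → a = b ∧ f = 0 := fun {a b} h =>
    int_add_fract_inj hf0 hf1 le_rfl one_pos (by simpa using h)
  have F' : ∀ {a b : ℤ}, (a : ℝ) - f = b → a = b ∧ f = 0 := fun {a b} h => by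
    have := int_add_fract_inj hf0 hf1 le_rfl one_pos (a := -a) (b := -b) (by push_cast; linarith)
    exact ⟨by omega, this.2⟩
  have G : ∀ {a b : ℤ}, (a : ℝ) = b + g → a = b ∧ g = 0 := fun {a b} h => by
    have := int_add_fract_inj hg0 hg1 le_rfl one_pos (a := b) (b := a) (by linarith)
    exact ⟨this.1.symm, this.2⟩
  have G' : ∀ {a b : ℤ}, (a : ℝ) = b - g → a = b ∧ g = 0 := fun {a b} h => by
    have := int_add_fract_inj hg0 hg1 le_rfl one_pos (a := -b) (b := -a) (by push_cast; linarith)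
    exact ⟨by omega, this.2⟩
  rcases hσ.adj x y with e | e | e | e | e
  · exact absurd e hv
  all_goals
    rcases hσ.adj x' y' with e' | e' | e' | e' | e'
    · exact absurd e' hw
    all_goals
      simp only [edgePoint, e, e', Prod.mk.injEq, Int.cast_add, Int.cast_sub, Int.cast_one,
        add_sub_cancel_left, sub_self, mul_zero, add_zero, mul_one, sub_sub_cancel_left, mul_neg,
        ← sub_eq_add_neg, Int.cast_inj] at h
      obtain ⟨h1, h2⟩ := h
      first
      | (obtain ⟨rfl, rfl⟩ := A h1; subst h2; exact ⟨rfl, rfl⟩)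
      | (obtain ⟨rfl, rfl⟩ := A' h1; subst h2; exact ⟨rfl, rfl⟩)
      | (obtain ⟨rfl, rfl⟩ := A h2; subst h1; exact ⟨rfl, rfl⟩)
      | (obtain ⟨rfl, rfl⟩ := A' h2; subst h1; exact ⟨rfl, rfl⟩)
      | (have := F h1; have := G h2; grind)
      | (have := F h1; have := G' h2; grind)
      | (have := F' h1; have := G h2; grind)
      | (have := F' h1; have := G' h2; grind)
      | (have := G h1; have := F h2; grind)
      | (have := G h1; have := F' h2; grind)
      | (have := G' h1; have := F h2; grind)
      | (have := G' h1; have := F' h2; grind)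
      | (have := B h1; grind)
      | (have := B h2; grind)
      | (have := B' h1; grind)
      | (have := B' h2; grind)

/-- The orbit of `v` under `σ`. -/
def orb (σ : Equiv.Perm (ℤ × ℤ)) (v : ℤ × ℤ) : Set (ℤ × ℤ) := {w | σ.SameCycle v w}

theorem self_mem_orb (σ : Equiv.Perm (ℤ × ℤ)) (v : ℤ × ℤ) : v ∈ orb σ v :=
  Equiv.Perm.SameCycle.refl σ v

theorem apply_mem_orb_iff {σ : Equiv.Perm (ℤ × ℤ)} {v w : ℤ × ℤ} : σ w ∈ orb σ v ↔ w ∈ orb σ v :=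
  Equiv.Perm.sameCycle_apply_right

/-- The unit speed path along the stitches of the orbit of `v`. -/
noncomputable def walk (σ : Equiv.Perm (ℤ × ℤ)) (v : ℤ × ℤ) (t : ℝ) : ℝ × ℝ :=
  edgePoint σ ((σ ^ ⌊t⌋) v) (Int.fract t)

theorem walk_eq_of_mem_Icc {σ : Equiv.Perm (ℤ × ℤ)} {v : ℤ × ℤ} {t : ℝ} {n : ℤ}
    (h : t ∈ Set.Icc (n : ℝ) (n + 1)) : walk σ v t = edgePoint σ ((σ ^ n) v) (t - n) := by
  rcases h.2.lt_or_eq with h1 | rfl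
  · have : ⌊t⌋ = n := Int.floor_eq_iff.2 ⟨h.1, h1⟩
    rw [walk, Int.fract, this]
  · have : ⌊(n : ℝ) + 1⌋ = n + 1 := by simp
    rw [walk, Int.fract, this, add_sub_cancel_left, edgePoint_one, ← Equiv.Perm.mul_apply,
      ← zpow_one_add, add_comm n 1]
    simp [add_comm]

theorem continuous_walk (σ : Equiv.Perm (ℤ × ℤ)) (v : ℤ × ℤ) : Continuous (walk σ v) := by
  refine locallyFinite_Icc_int.continuous ?_ (fun n => isClosed_Icc) fun n => ?_
  · refine Set.eq_univ_of_forall fun t => Set.mem_iUnion.2 ⟨⌊t⌋, Int.floor_le t, ?_⟩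
    exact (Int.lt_floor_add_one t).le
  · refine ContinuousOn.congr ?_ fun t ht => walk_eq_of_mem_Icc ht
    unfold edgePoint
    fun_prop

theorem apply_ne_of_mem_orb {σ : Equiv.Perm (ℤ × ℤ)} {v w : ℤ × ℤ} (hv : σ v ≠ v)
    (hw : w ∈ orb σ v) : σ w ≠ w := by
  rwa [Ne, ← Equiv.Perm.SameCycle.apply_eq_self_iff hw]

theorem IsLatticeFlow.range_walk {σ : Equiv.Perm (ℤ × ℤ)} (hσ : IsLatticeFlow σ) {v : ℤ × ℤ}
    (hv : σ v ≠ v) : Set.range (walk σ v) = curveOf (edgeSet σ (orb σ v)) := by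
  ext p
  rw [hσ.mem_curveOf_edgeSet_Ico fun w hw => apply_mem_orb_iff.2 hw]
  constructor
  · rintro ⟨t, rfl⟩
    have : (σ ^ ⌊t⌋) v ∈ orb σ v := ⟨⌊t⌋, rfl⟩
    exact ⟨_, this, apply_ne_of_mem_orb hv this, _, Int.fract_nonneg t, Int.fract_lt_one t, rfl⟩
  · rintro ⟨w, ⟨n, rfl⟩, -, f, h0, h1, rfl⟩
    refine ⟨n + f, ?_⟩
    rw [walk_eq_of_mem_Icc (n := n) ⟨by linarith, by linarith⟩, add_sub_cancel_left]

theorem IsLatticeFlow.isPreconnected_orb {σ : Equiv.Perm (ℤ × ℤ)} (hσ : IsLatticeFlow σ)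
    {v : ℤ × ℤ} (hv : σ v ≠ v) : IsPreconnected (curveOf (edgeSet σ (orb σ v))) := by
  rw [← hσ.range_walk hv]
  exact isPreconnected_range (continuous_walk σ v)

theorem edgeSet_mono (σ : Equiv.Perm (ℤ × ℤ)) {O P : Set (ℤ × ℤ)} (h : O ⊆ P) :
    edgeSet σ O ⊆ edgeSet σ P := by
  rintro (⟨i, j⟩ | ⟨i, j⟩) hs
  · exact hs.imp (fun H => ⟨h H.1, H.2⟩) fun H => ⟨h H.1, H.2⟩
  · exact hs.imp (fun H => ⟨h H.1, H.2⟩) fun H => ⟨h H.1, H.2⟩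

theorem IsLatticeFlow.disjoint_curveOf {σ : Equiv.Perm (ℤ × ℤ)} (hσ : IsLatticeFlow σ)
    {O P : Set (ℤ × ℤ)} (hO : ∀ v ∈ O, σ v ∈ O) (hP : ∀ v ∈ P, σ v ∈ P) (h : Disjoint O P) :
    Disjoint (curveOf (edgeSet σ O)) (curveOf (edgeSet σ P)) := by
  rw [Set.disjoint_left]
  intro p hp hp'
  obtain ⟨v, hv, hne, f, h0, h1, rfl⟩ := (hσ.mem_curveOf_edgeSet_Ico hO).1 hp
  obtain ⟨w, hw, hne', g, h0', h1', h2⟩ := (hσ.mem_curveOf_edgeSet_Ico hP).1 hp'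
  obtain ⟨rfl, -⟩ := hσ.edgePoint_inj hne hne' h0 h1 h0' h1' h2
  exact Set.disjoint_left.1 h hv hw

theorem IsLatticeFlow.connectedComponentIn_eq {σ : Equiv.Perm (ℤ × ℤ)} (hσ : IsLatticeFlow σ)
    {v : ℤ × ℤ} (hv : σ v ≠ v) {p : ℝ × ℝ} (hp : p ∈ curveOf (edgeSet σ (orb σ v))) :
    connectedComponentIn (curveOf (edgeSet σ Set.univ)) p = curveOf (edgeSet σ (orb σ v)) := by
  have hsub : curveOf (edgeSet σ (orb σ v)) ⊆ curveOf (edgeSet σ Set.univ) :=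
    curveOf_mono (edgeSet_mono σ (Set.subset_univ _))
  apply Set.Subset.antisymm
  · have hpre := isPreconnected_connectedComponentIn (x := p)
      (F := curveOf (edgeSet σ Set.univ))
    have hdisj := hσ.disjoint_curveOf (O := orb σ v) (P := (orb σ v)ᶜ)
      (fun w hw => apply_mem_orb_iff.2 hw) (fun w hw h => hw (apply_mem_orb_iff.1 h))
      disjoint_compl_right
    have hcov : connectedComponentIn (curveOf (edgeSet σ Set.univ)) p ⊆
        curveOf (edgeSet σ (orb σ v)) ∪ curveOf (edgeSet σ (orb σ v)ᶜ) := by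
      refine (connectedComponentIn_subset _ _).trans fun q hq => ?_
      obtain ⟨w, -, hne, f, hf⟩ := hσ.mem_curveOf_edgeSet.1 hq
      by_cases hw : w ∈ orb σ v
      · exact Or.inl (hσ.mem_curveOf_edgeSet.2 ⟨w, hw, hne, f, hf⟩)
      · exact Or.inr (hσ.mem_curveOf_edgeSet.2 ⟨w, hw, hne, f, hf⟩)
    rcases isPreconnected_iff_subset_of_disjoint_closed.1 hpre _ _ (isClosed_curveOf _)
      (isClosed_curveOf _) hcov (by rw [hdisj.inter_eq, Set.inter_empty]) with h | h
    · exact h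
    · exact absurd (h (mem_connectedComponentIn (hsub hp))) (Set.disjoint_left.1 hdisj hp)
  · exact (hσ.isPreconnected_orb hv).subset_connectedComponentIn hp hsub

theorem IsLatticeFlow.walk_eq_walk_iff {σ : Equiv.Perm (ℤ × ℤ)} (hσ : IsLatticeFlow σ)
    {v : ℤ × ℤ} (hv : σ v ≠ v) {s t : ℝ} :
    walk σ v s = walk σ v t ↔ (σ ^ ⌊s⌋) v = (σ ^ ⌊t⌋) v ∧ Int.fract s = Int.fract t := by
  refine ⟨fun h => ?_, fun ⟨h, h'⟩ => by rw [walk, walk, h, h']⟩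
  exact hσ.edgePoint_inj (apply_ne_of_mem_orb hv ⟨_, rfl⟩) (apply_ne_of_mem_orb hv ⟨_, rfl⟩)
    (Int.fract_nonneg s) (Int.fract_lt_one s) (Int.fract_nonneg t) (Int.fract_lt_one t) h

theorem mem_periodicPts_of_finite_orb {σ : Equiv.Perm (ℤ × ℤ)} {v : ℤ × ℤ}
    (hfin : (orb σ v).Finite) : v ∈ Function.periodicPts σ := by
  by_contra hnot
  have hinj : Function.Injective fun n : ℕ => (σ ^ n) v := by
    intro m n hmn
    simp only [Equiv.Perm.coe_pow] at hmn
    by_contra hne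
    refine hnot ?_
    rcases lt_or_gt_of_ne hne with h | h
    · refine ⟨n - m, by omega, ?_⟩
      have := Function.iterate_cancel σ.injective hmn.symm
      exact this
    · refine ⟨m - n, by omega, ?_⟩
      exact Function.iterate_cancel σ.injective hmn
  exact Set.infinite_of_injective_forall_mem hinj
    (fun n => (⟨n, by simp⟩ : σ.SameCycle v ((σ ^ n) v))) hfin

theorem IsLatticeFlow.nonempty_homeomorph_addCircle {σ : Equiv.Perm (ℤ × ℤ)}
    (hσ : IsLatticeFlow σ) {v : ℤ × ℤ} (hv : σ v ≠ v) (hfin : (orb σ v).Finite) :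
    Nonempty (AddCircle (1 : ℝ) ≃ₜ curveOf (edgeSet σ (orb σ v))) := by
  have hN : 0 < Function.minimalPeriod σ v := Function.minimalPeriod_pos_of_mem_periodicPts (mem_periodicPts_of_finite_orb hfin)
  set N := Function.minimalPeriod σ v with hNdef
  have hdvd : ∀ n : ℤ, (σ ^ n) v = v ↔ (N : ℤ) ∣ n := fun n =>
    MulAction.zpow_smul_eq_iff_minimalPeriod_dvd (a := σ) (b := v)
  have hNr : (0 : ℝ) < N := by exact_mod_cast hN
  have : Fact ((0 : ℝ) < N) := ⟨hNr⟩
  have hperiod : Function.Periodic (walk σ v) (N : ℝ) := by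
    intro t
    rw [hσ.walk_eq_walk_iff hv]
    have h1 : ⌊t + (N : ℝ)⌋ = ⌊t⌋ + N := by exact_mod_cast Int.floor_add_natCast t N
    refine ⟨?_, by simp⟩
    rw [h1, zpow_add, Equiv.Perm.mul_apply, (hdvd N).2 dvd_rfl]
  let F : AddCircle (N : ℝ) → curveOf (edgeSet σ (orb σ v)) := fun x =>
    ⟨hperiod.lift x, by
      rw [← hσ.range_walk hv]
      induction x using QuotientAddGroup.induction_on with
      | H t => exact ⟨t, (hperiod.lift_coe t).symm⟩⟩
  have hF : ∀ t : ℝ, (F (t : AddCircle (N : ℝ)) : ℝ × ℝ) = walk σ v t := fun t =>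
    hperiod.lift_coe t
  have hcont : Continuous F := by
    refine Continuous.subtype_mk ?_ _
    exact continuous_coinduced_dom.2 (continuous_walk σ v)
  have hbij : Function.Bijective F := by
    constructor
    · intro x y hxy
      induction x using QuotientAddGroup.induction_on with
      | H s =>
        induction y using QuotientAddGroup.induction_on with
        | H t =>
          have h := congrArg Subtype.val hxy
          rw [hF, hF, hσ.walk_eq_walk_iff hv] at h
          obtain ⟨h1, h2⟩ := h
          have h3 : (σ ^ (⌊s⌋ - ⌊t⌋)) v = v := by
            rw [sub_eq_neg_add, zpow_add, Equiv.Perm.mul_apply, h1, ← Equiv.Perm.mul_apply,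
              ← zpow_add]
            simp
          obtain ⟨m, hm⟩ := (hdvd _).1 h3
          refine (QuotientAddGroup.eq_iff_sub_mem).2 ?_
          refine AddSubgroup.mem_zmultiples_iff.2 ⟨m, ?_⟩
          have h4 : s - t = (⌊s⌋ - ⌊t⌋ : ℤ) := by
            have := Int.floor_add_fract s
            have := Int.floor_add_fract t
            push_cast
            linarith
          rw [h4, hm]
          simp [mul_comm]
    · rintro ⟨p, hp⟩
      obtain ⟨t, rfl⟩ := (hσ.range_walk hv).symm ▸ hp
      exact ⟨(t : AddCircle (N : ℝ)), Subtype.ext (hF t)⟩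
  exact ⟨(AddCircle.homeomorphAddCircle 1 (N : ℝ) one_ne_zero hNr.ne').trans
    (hcont.homeoOfEquivCompactToT2 (f := Equiv.ofBijective F hbij))⟩

theorem IsLatticeFlow.isCircle_of_isCircle {σ τ : Equiv.Perm (ℤ × ℤ)} (hσ : IsLatticeFlow σ)
    (hτ : IsLatticeFlow τ) {v w : ℤ × ℤ} (hv : σ v ≠ v) (hw : τ w ≠ w) (hfv : (orb σ v).Finite)
    (hfw : (orb τ w).Finite) (h : IsCircle (curveOf (edgeSet σ (orb σ v)))) :
    IsCircle (curveOf (edgeSet τ (orb τ w))) := by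
  obtain ⟨e⟩ := hσ.nonempty_homeomorph_addCircle hv hfv
  obtain ⟨f⟩ := hτ.nonempty_homeomorph_addCircle hw hfw
  exact h.map fun g => (f.symm.trans e).trans g

theorem IsCircle.isBounded {C : Set (ℝ × ℝ)} (h : IsCircle C) : Bornology.IsBounded C := by
  obtain ⟨e⟩ := h
  have : CompactSpace (Metric.sphere (0 : ℝ × ℝ) 1) :=
    isCompact_iff_compactSpace.1 (isCompact_sphere _ _)
  have : CompactSpace C := e.symm.compactSpace
  exact (isCompact_iff_compactSpace.2 this).isBounded

theorem IsLatticeFlow.intCast_mem_curveOf {σ : Equiv.Perm (ℤ × ℤ)} (hσ : IsLatticeFlow σ)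
    {O : Set (ℤ × ℤ)} {x y : ℤ} (hv : (x, y) ∈ O) (hne : σ (x, y) ≠ (x, y)) :
    ((x : ℝ), (y : ℝ)) ∈ curveOf (edgeSet σ O) :=
  hσ.mem_curveOf_edgeSet.2 ⟨_, hv, hne, 0, le_rfl, zero_le_one, by simp [edgePoint]⟩

theorem finite_of_isBounded_intCast {O : Set (ℤ × ℤ)} {C : Set (ℝ × ℝ)}
    (hC : Bornology.IsBounded C) (h : ∀ v ∈ O, ((v.1 : ℝ), (v.2 : ℝ)) ∈ C) : O.Finite := by
  obtain ⟨R, hR⟩ := hC.subset_closedBall 0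
  refine ((Set.finite_Icc (-⌈R⌉) ⌈R⌉).prod (Set.finite_Icc (-⌈R⌉) ⌈R⌉)).subset fun v hv => ?_
  have h1 := hR (h v hv)
  rw [mem_closedBall_zero_iff, Prod.norm_def, sup_le_iff, Real.norm_eq_abs, Real.norm_eq_abs,
    abs_le, abs_le] at h1
  obtain ⟨⟨h1, h2⟩, h3, h4⟩ := h1
  have hle := Int.le_ceil R
  have k1 : ((-⌈R⌉ : ℤ) : ℝ) ≤ v.1 := by push_cast; linarith
  have k2 : (v.1 : ℝ) ≤ ⌈R⌉ := by linarith
  have k3 : ((-⌈R⌉ : ℤ) : ℝ) ≤ v.2 := by push_cast; linarith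
  have k4 : (v.2 : ℝ) ≤ ⌈R⌉ := by linarith
  exact ⟨⟨by exact_mod_cast k1, by exact_mod_cast k2⟩, by exact_mod_cast k3, by exact_mod_cast k4⟩

theorem mem_cell {a b : ℤ} {p : ℝ × ℝ} : p ∈ cell a b ↔
    ((a : ℝ) < p.1 ∧ p.1 < a + 1) ∧ (b : ℝ) < p.2 ∧ p.2 < b + 1 := Iff.rfl

theorem disjoint_cell_curveOf (a b : ℤ) (S : Set Stitch) : Disjoint (cell a b) (curveOf S) := by
  rw [Set.disjoint_left]
  intro p hp hpS
  rw [mem_cell] at hp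
  obtain ⟨⟨h1, h2⟩, h3, h4⟩ := hp
  obtain ⟨s, -, hs⟩ := mem_curveOf.1 hpS
  rcases s with ⟨i, j⟩ | ⟨i, j⟩
  · rw [(mem_seg_vert.1 hs).1] at h1 h2
    norm_cast at h1 h2
    omega
  · rw [(mem_seg_horiz.1 hs).2] at h3 h4
    norm_cast at h3 h4
    omega

theorem isPreconnected_cell (a b : ℤ) : IsPreconnected (cell a b) :=
  isPreconnected_Ioo.prod isPreconnected_Ioo

theorem cell_nonempty (a b : ℤ) : (cell a b).Nonempty :=
  ⟨((a : ℝ) + 1 / 2, (b : ℝ) + 1 / 2), mem_cell.2 (by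
    refine ⟨⟨?_, ?_⟩, ?_, ?_⟩ <;> norm_num)⟩

theorem mem_intOf_of_isPreconnected {C A : Set (ℝ × ℝ)} {p q : ℝ × ℝ} (hA : IsPreconnected A)
    (hAC : Disjoint A C) (hp : p ∈ A) (hq : q ∈ A) (h : p ∈ intOf C) : q ∈ intOf C := by
  have hsub : A ⊆ Cᶜ := hAC.subset_compl_right
  refine ⟨hsub hq, ?_⟩
  rw [← connectedComponentIn_eq (hA.subset_connectedComponentIn hp hsub hq)]
  exact h.2

theorem insert_cell_subset_intOf {S : Set Stitch} {a b : ℤ} {p q : ℝ × ℝ}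
    (hp : p ∈ closedCell (a, b)) (hpC : p ∉ curveOf S) (hq : q ∈ insert p (cell a b))
    (h : q ∈ intOf (curveOf S)) : insert p (cell a b) ⊆ intOf (curveOf S) := by
  intro r hr
  refine mem_intOf_of_isPreconnected (A := insert p (cell a b)) ?_ ?_ hq hr h
  · refine (isPreconnected_cell a b).subset_closure (Set.subset_insert _ _) ?_
    rw [closure_cell]
    refine Set.insert_subset hp ?_
    rw [← closure_cell]
    exact subset_closure
  · rw [Set.disjoint_insert_left]
    exact ⟨hpC, disjoint_cell_curveOf a b S⟩

theorem mem_intOf_of_cell_subset {S : Set Stitch} {a b : ℤ} {p : ℝ × ℝ}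
    (hp : p ∈ closedCell (a, b)) (hpC : p ∉ curveOf S) (h : cell a b ⊆ intOf (curveOf S)) :
    p ∈ intOf (curveOf S) := by
  obtain ⟨q, hq⟩ := cell_nonempty a b
  exact insert_cell_subset_intOf hp hpC (Set.mem_insert_of_mem _ hq) (h hq) (Set.mem_insert _ _)

theorem cell_subset_of_mem_intOf {S : Set Stitch} {a b : ℤ} {p : ℝ × ℝ}
    (hp : p ∈ closedCell (a, b)) (h : p ∈ intOf (curveOf S)) : cell a b ⊆ intOf (curveOf S) :=
  (Set.subset_insert _ _).trans (insert_cell_subset_intOf hp h.1 (Set.mem_insert _ _) h)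

theorem cell_subset_intOf_iff {S : Set Stitch} {a b a' b' : ℤ} {p : ℝ × ℝ}
    (hp : p ∈ closedCell (a, b)) (hp' : p ∈ closedCell (a', b')) (hpC : p ∉ curveOf S) :
    cell a b ⊆ intOf (curveOf S) ↔ cell a' b' ⊆ intOf (curveOf S) :=
  ⟨fun h => cell_subset_of_mem_intOf hp' (mem_intOf_of_cell_subset hp hpC h),
    fun h => cell_subset_of_mem_intOf hp (mem_intOf_of_cell_subset hp' hpC h)⟩

theorem cell_subset_intOf_iff_of_vert {S : Set Stitch} {i j : ℤ} (h : Stitch.vert i j ∉ S) :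
    cell (i - 1) j ⊆ intOf (curveOf S) ↔ cell i j ⊆ intOf (curveOf S) := by
  refine cell_subset_intOf_iff (p := (Stitch.vert i j).mid) ?_ ?_ (mt mid_mem_curveOf.1 h) <;>
    rw [mem_closedCell] <;> simp only [Stitch.mid] <;> push_cast <;>
    refine ⟨⟨?_, ?_⟩, ?_, ?_⟩ <;> linarith

theorem cell_subset_intOf_iff_of_horiz {S : Set Stitch} {i j : ℤ} (h : Stitch.horiz i j ∉ S) :
    cell i (j - 1) ⊆ intOf (curveOf S) ↔ cell i j ⊆ intOf (curveOf S) := by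
  refine cell_subset_intOf_iff (p := (Stitch.horiz i j).mid) ?_ ?_ (mt mid_mem_curveOf.1 h) <;>
    rw [mem_closedCell] <;> simp only [Stitch.mid] <;> push_cast <;>
    refine ⟨⟨?_, ?_⟩, ?_, ?_⟩ <;> linarith

theorem not_mem_intOf_of_lt {C : Set (ℝ × ℝ)} {Y : ℝ} (hC : ∀ p ∈ C, p.2 ≤ Y) {p : ℝ × ℝ}
    (hp : Y < p.2) : p ∉ intOf C := by
  intro h
  have hsub : Set.univ ×ˢ Set.Ioi Y ⊆ Cᶜ := fun q hq hqC => (hC q hqC).not_gt hq.2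
  have hb := h.2.subset ((isPreconnected_univ.prod isPreconnected_Ioi).subset_connectedComponentIn
    (⟨Set.mem_univ _, hp⟩ : p ∈ Set.univ ×ˢ Set.Ioi Y) hsub)
  have := hb.image_fst
  rw [Set.fst_image_prod _ ⟨Y + 1, by simp⟩] at this
  exact NormedSpace.unbounded_univ ℝ ℝ this

/-- The cell to the left of the stitch from `v` to `σ v` satisfies `P`. -/
def LeftCell (P : ℤ → ℤ → Prop) (σ : Equiv.Perm (ℤ × ℤ)) (v : ℤ × ℤ) : Prop :=
  (σ v = (v.1 + 1, v.2) → P v.1 v.2) ∧ (σ v = (v.1 - 1, v.2) → P (v.1 - 1) (v.2 - 1)) ∧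
    (σ v = (v.1, v.2 + 1) → P (v.1 - 1) v.2) ∧ (σ v = (v.1, v.2 - 1) → P v.1 (v.2 - 1))

section LeftCell

variable {P : ℤ → ℤ → Prop} {σ : Equiv.Perm (ℤ × ℤ)} {x y : ℤ}

theorem leftCell_east (h : σ (x, y) = (x + 1, y)) : LeftCell P σ (x, y) ↔ P x y := by
  have : x + 1 ≠ x - 1 := by omega
  simp [LeftCell, h, this]

theorem leftCell_west (h : σ (x, y) = (x - 1, y)) : LeftCell P σ (x, y) ↔ P (x - 1) (y - 1) := by
  have : x - 1 ≠ x + 1 := by omega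
  have : x - 1 ≠ x := by omega
  simp [LeftCell, *]

theorem leftCell_north (h : σ (x, y) = (x, y + 1)) : LeftCell P σ (x, y) ↔ P (x - 1) y := by
  have : x ≠ x - 1 := by omega
  have : y + 1 ≠ y - 1 := by omega
  simp [LeftCell, *]

theorem leftCell_south (h : σ (x, y) = (x, y - 1)) : LeftCell P σ (x, y) ↔ P x (y - 1) := by
  have : x ≠ x - 1 := by omega
  have : y - 1 ≠ y + 1 := by omega
  simp [LeftCell, *]

end LeftCell

theorem IsLatticeFlow.leftCell_apply_iff {P : ℤ → ℤ → Prop} {σ : Equiv.Perm (ℤ × ℤ)}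
    (hσ : IsLatticeFlow σ)
    (hV : ∀ i j, Stitch.vert i j ∉ edgeSet σ Set.univ → (P (i - 1) j ↔ P i j))
    (hH : ∀ i j, Stitch.horiz i j ∉ edgeSet σ Set.univ → (P i (j - 1) ↔ P i j))
    (v : ℤ × ℤ) : LeftCell P σ (σ v) ↔ LeftCell P σ v := by
  obtain ⟨x, y⟩ := v
  by_cases hfix : σ (x, y) = (x, y)
  · rw [hfix]
  have hne : σ (σ (x, y)) ≠ σ (x, y) := fun h => hfix (σ.injective h)
  have hback : σ (σ (x, y)) ≠ (x, y) := fun h => hfix (hσ.noBack (x, y) h)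
  obtain ⟨p, q, hw⟩ : ∃ p q, σ (x, y) = (p, q) := ⟨_, _, rfl⟩
  have hinj : ∀ a b : ℤ, σ (a, b) = (p, q) → a = x ∧ b = y := fun a b h => by
    have := σ.injective (h.trans hw.symm)
    simpa using this
  have hN := hV p q
  have hS := hV p (q - 1)
  have hE := hH p q
  have hW := hH (p - 1) q
  have iN := hinj p (q + 1)
  have iS := hinj p (q - 1)
  have iE := hinj (p + 1) q
  have iW := hinj (p - 1) q
  have hadj := hσ.adj x y
  rw [hw] at hne hback hfix hadj ⊢
  simp only [vert_mem_edgeSet, horiz_mem_edgeSet, Set.mem_univ, true_and, sub_add_cancel]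
    at hN hS hE hW
  clear hV hH hinj
  have key : LeftCell P σ (p, q) ↔ ((p, q) = (x + 1, y) ∧ P (p - 1) q) ∨
      ((p, q) = (x - 1, y) ∧ P p (q - 1)) ∨ ((p, q) = (x, y + 1) ∧ P (p - 1) (q - 1)) ∨
      ((p, q) = (x, y - 1) ∧ P p q) := by
    rcases hσ.adj p q with e | e | e | e | e
    · exact absurd e hne
    · rw [leftCell_east e]
      simp only [e, Prod.mk.injEq] at *
      grind
    · rw [leftCell_west e]
      simp only [e, Prod.mk.injEq] at *
      grind
    · rw [leftCell_north e]
      simp only [e, Prod.mk.injEq] at *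
      grind
    · rw [leftCell_south e]
      simp only [e, Prod.mk.injEq] at *
      grind
  rw [key]
  clear key hN hS hE hW iN iS iE iW hback
  rcases hadj with e | e | e | e | e
  · exact absurd e hfix
  · rw [e] at hw
    rw [leftCell_east hw]
    simp only [Prod.mk.injEq] at e ⊢
    grind
  · rw [e] at hw
    rw [leftCell_west hw]
    simp only [Prod.mk.injEq] at e ⊢
    grind
  · rw [e] at hw
    rw [leftCell_north hw]
    simp only [Prod.mk.injEq] at e ⊢
    grind
  · rw [e] at hw
    rw [leftCell_south hw]
    simp only [Prod.mk.injEq] at e ⊢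
    grind

theorem iff_of_mem_orb {Q : ℤ × ℤ → Prop} {σ : Equiv.Perm (ℤ × ℤ)} (h : ∀ v, Q (σ v) ↔ Q v)
    {v w : ℤ × ℤ} (hw : w ∈ orb σ v) : Q w ↔ Q v := by
  obtain ⟨n, rfl⟩ := hw
  induction n using Int.induction_on with
  | zero => rfl
  | succ n ih => rw [← ih, add_comm, zpow_one_add, Equiv.Perm.mul_apply, h]
  | pred n ih =>
    rw [← ih, ← h, ← Equiv.Perm.mul_apply, ← zpow_one_add]
    congr! 3
    ring

/-- The left cells of the stitches of an orbit are all inside or all outside its curve. -/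
theorem IsLatticeFlow.leftCell_intOf_iff {σ : Equiv.Perm (ℤ × ℤ)} (hσ : IsLatticeFlow σ)
    {u v w : ℤ × ℤ} (hv : v ∈ orb σ u) (hw : w ∈ orb σ u) :
    LeftCell (fun a b => cell a b ⊆ intOf (curveOf (edgeSet σ (orb σ u)))) σ v ↔
      LeftCell (fun a b => cell a b ⊆ intOf (curveOf (edgeSet σ (orb σ u)))) σ w := by
  have h := hσ.leftCell_apply_iff
    (P := fun a b => cell a b ⊆ intOf (curveOf (edgeSet σ (orb σ u))))
    (fun i j hij => cell_subset_intOf_iff_of_vert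
      fun h => hij (edgeSet_mono σ (Set.subset_univ _) h))
    (fun i j hij => cell_subset_intOf_iff_of_horiz
      fun h => hij (edgeSet_mono σ (Set.subset_univ _) h))
  rw [iff_of_mem_orb h hv, iff_of_mem_orb h hw]

section Winding

open Classical in
/-- The westward flow of `σ` on `O` through the stitch `horiz a b`. -/
noncomputable def westFlow (σ : Equiv.Perm (ℤ × ℤ)) (O : Set (ℤ × ℤ)) (a b : ℤ) : ℤ :=
  (if (a + 1, b) ∈ O ∧ σ (a + 1, b) = (a, b) then 1 else 0) -
    if (a, b) ∈ O ∧ σ (a, b) = (a + 1, b) then 1 else 0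

open Classical in
/-- The northward flow of `σ` on `O` through the stitch `vert a b`. -/
noncomputable def northFlow (σ : Equiv.Perm (ℤ × ℤ)) (O : Set (ℤ × ℤ)) (a b : ℤ) : ℤ :=
  (if (a, b) ∈ O ∧ σ (a, b) = (a, b + 1) then 1 else 0) -
    if (a, b + 1) ∈ O ∧ σ (a, b + 1) = (a, b) then 1 else 0

/-- The winding number around the cell `(a, b)` of the orbits in `O`, when `O` lies below
height `Y`. -/
noncomputable def winding (σ : Equiv.Perm (ℤ × ℤ)) (O : Set (ℤ × ℤ)) (Y a b : ℤ) : ℤ :=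
  ∑ y ∈ Finset.Ioc b Y, westFlow σ O a y

variable {σ : Equiv.Perm (ℤ × ℤ)} {O : Set (ℤ × ℤ)} {Y a b : ℤ}

theorem westFlow_eq_zero (h : Stitch.horiz a b ∉ edgeSet σ O) : westFlow σ O a b = 0 := by
  rw [horiz_mem_edgeSet, not_or] at h
  rw [westFlow, if_neg h.1, if_neg h.2, sub_zero]

theorem northFlow_eq_zero (h : Stitch.vert a b ∉ edgeSet σ O) : northFlow σ O a b = 0 := by
  rw [vert_mem_edgeSet, not_or] at h
  rw [northFlow, if_neg h.1, if_neg h.2, sub_zero]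

theorem IsLatticeFlow.westFlow_sub (hσ : IsLatticeFlow σ) (hO : ∀ v, σ v ∈ O ↔ v ∈ O)
    (a b : ℤ) :
    westFlow σ O a b - westFlow σ O (a - 1) b = northFlow σ O a b - northFlow σ O a (b - 1) := by
  by_cases hv : (a, b) ∈ O
  swap
  · have hn : ∀ w, ¬(w ∈ O ∧ σ w = (a, b)) := fun w ⟨h1, h2⟩ => hv (h2 ▸ (hO w).2 h1)
    simp [westFlow, northFlow, hv, hn]
  have hm : ∀ w, (w ∈ O ∧ σ w = (a, b)) ↔ σ.symm (a, b) = w := fun w => by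
    rw [Equiv.symm_apply_eq]
    exact ⟨fun h => h.2.symm, fun h => ⟨(hO w).1 (h ▸ hv), h.symm⟩⟩
  simp only [westFlow, northFlow, sub_add_cancel, hv, true_and, hm]
  obtain ⟨⟨p, q⟩, hu⟩ : ∃ u, σ.symm (a, b) = u := ⟨_, rfl⟩
  have hpq := hσ.adj p q
  rw [← hu, Equiv.apply_symm_apply, hu] at hpq
  have hfix : (p, q) = (a, b) ↔ σ (a, b) = (a, b) := by
    rw [← hu, Equiv.symm_apply_eq, eq_comm]
  rw [hu]
  have hab := hσ.adj a b
  simp only [Prod.mk.injEq] at hpq hfix ⊢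
  rcases hab with e | e | e | e | e <;> simp only [e, Prod.mk.injEq] at hfix ⊢
  all_goals
    rcases hpq with e' | e' | e' | e' | e' <;> obtain ⟨rfl, rfl⟩ := e' <;> grind

theorem winding_sub_one (hY : ∀ v ∈ O, v.2 ≤ Y) (a b : ℤ) :
    winding σ O Y a (b - 1) = westFlow σ O a b + winding σ O Y a b := by
  by_cases h : b ≤ Y
  · have : Finset.Ioc (b - 1) Y = insert b (Finset.Ioc b Y) := by
      ext y; simp; omega
    rw [winding, this, Finset.sum_insert (by simp)]
    rfl
  · have h1 : Finset.Ioc (b - 1) Y = ∅ := Finset.Ioc_eq_empty (by omega)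
    have h2 : Finset.Ioc b Y = ∅ := Finset.Ioc_eq_empty (by omega)
    have h3 : westFlow σ O a b = 0 := by
      apply westFlow_eq_zero
      rw [horiz_mem_edgeSet]
      rintro (⟨h', -⟩ | ⟨h', -⟩) <;> exact h (hY _ h')
    rw [winding, winding, h1, h2, h3]
    simp

theorem IsLatticeFlow.winding_sub (hσ : IsLatticeFlow σ) (hO : ∀ v, σ v ∈ O ↔ v ∈ O)
    (hY : ∀ v ∈ O, v.2 ≤ Y) (a b : ℤ) :
    winding σ O Y a b - winding σ O Y (a - 1) b = - northFlow σ O a b := by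
  by_cases h : b ≤ Y
  · induction b, h using Int.leInductionDown with
    | base =>
      rw [northFlow_eq_zero]
      · simp [winding]
      · rw [vert_mem_edgeSet]
        rintro (⟨h, e⟩ | ⟨h, -⟩)
        · have := hY _ ((hO _).2 h)
          rw [e] at this
          simp at this
        · have := hY _ h
          simp at this
    | pred b hb ih =>
      have := hσ.westFlow_sub hO a b
      rw [winding_sub_one hY, winding_sub_one hY]
      linarith
  · rw [northFlow_eq_zero]
    · have : Finset.Ioc b Y = ∅ := Finset.Ioc_eq_empty (by omega)
      simp [winding, this]
    · rw [vert_mem_edgeSet]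
      rintro (⟨h', -⟩ | ⟨h', -⟩) <;> have := hY _ h' <;> simp at this <;> omega

theorem IsLatticeFlow.winding_congr (hσ : IsLatticeFlow σ) (hO : ∀ v, σ v ∈ O ↔ v ∈ O)
    (hY : ∀ v ∈ O, v.2 ≤ Y) {a b a' b' : ℤ} {p : ℝ × ℝ} (hp : p ∈ closedCell (a, b))
    (hp' : p ∈ closedCell (a', b')) (hpC : p ∉ curveOf (edgeSet σ O)) :
    winding σ O Y a b = winding σ O Y a' b' := by
  have hvert : ∀ a b, p ∈ closedCell (a - 1, b) → p ∈ closedCell (a, b) →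
      winding σ O Y (a - 1) b = winding σ O Y a b := fun a b h h' => by
    have := hσ.winding_sub hO hY a b
    rw [northFlow_eq_zero] at this
    · linarith
    · rw [mem_closedCell] at h h'
      push_cast at h
      exact fun hs => hpC (mem_curveOf.2 ⟨_, hs, mem_seg_vert.2 ⟨by linarith, h'.2⟩⟩)
  have hhoriz : ∀ a b, p ∈ closedCell (a, b - 1) → p ∈ closedCell (a, b) →
      winding σ O Y a (b - 1) = winding σ O Y a b := fun a b h h' => by
    rw [winding_sub_one hY, westFlow_eq_zero, zero_add]
    rw [mem_closedCell] at h h'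
    push_cast at h
    exact fun hs => hpC (mem_curveOf.2 ⟨_, hs, mem_seg_horiz.2 ⟨h'.1, by linarith⟩⟩)
  have hadj : ∀ {m n : ℤ} {t : ℝ}, (m : ℝ) ≤ t ∧ t ≤ m + 1 → (n : ℝ) ≤ t ∧ t ≤ n + 1 →
      n = m ∨ n = m - 1 ∨ m = n - 1 := fun {m n t} h h' => by
    have h1 : (m : ℝ) ≤ n + 1 := by linarith
    have h2 : (n : ℝ) ≤ m + 1 := by linarith
    norm_cast at h1 h2
    omega
  have hq : p ∈ closedCell (a', b) := ⟨hp'.1, hp.2⟩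
  trans winding σ O Y a' b
  · rcases hadj hp.1 hp'.1 with e | e | e <;> dsimp only at e
    · rw [e]
    · subst e; exact (hvert _ _ hq hp).symm
    · subst e; exact hvert _ _ hp hq
  · rcases hadj hp.2 hp'.2 with e | e | e <;> dsimp only at e
    · rw [e]
    · subst e; exact (hhoriz _ _ hp' hq).symm
    · subst e; exact hhoriz _ _ hq hp'

theorem IsLatticeFlow.finite_winding_ne_zero (hσ : IsLatticeFlow σ)
    (hO : ∀ v, σ v ∈ O ↔ v ∈ O) (hfin : O.Finite) (hY : ∀ v ∈ O, v.2 ≤ Y) :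
    {c : ℤ × ℤ | winding σ O Y c.1 c.2 ≠ 0}.Finite := by
  obtain ⟨y₀, hy₀⟩ := (hfin.image Prod.snd).bddBelow
  obtain ⟨x₀, hx₀⟩ := (hfin.image Prod.fst).bddBelow
  obtain ⟨x₁, hx₁⟩ := (hfin.image Prod.fst).bddAbove
  replace hy₀ : ∀ v ∈ O, y₀ ≤ v.2 := fun v hv => hy₀ ⟨v, hv, rfl⟩
  replace hx₀ : ∀ v ∈ O, x₀ ≤ v.1 := fun v hv => hx₀ ⟨v, hv, rfl⟩
  replace hx₁ : ∀ v ∈ O, v.1 ≤ x₁ := fun v hv => hx₁ ⟨v, hv, rfl⟩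
  have hwest : ∀ a b, a < x₀ - 1 → winding σ O Y a b = 0 := fun a b h => by
    refine Finset.sum_eq_zero fun y _ => westFlow_eq_zero ?_
    rw [horiz_mem_edgeSet]
    rintro (⟨h', -⟩ | ⟨h', -⟩) <;> have := hx₀ _ h' <;> simp at this <;> omega
  have heast : ∀ a b, x₁ < a → winding σ O Y a b = 0 := fun a b h => by
    refine Finset.sum_eq_zero fun y _ => westFlow_eq_zero ?_
    rw [horiz_mem_edgeSet]
    rintro (⟨h', -⟩ | ⟨h', -⟩) <;> have := hx₁ _ h' <;> simp at this <;> omega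
  have hsouth : ∀ a b, b < y₀ - 1 → winding σ O Y a b = 0 := fun a b h => by
    rcases lt_or_ge a (x₀ - 1) with ha | ha
    · exact hwest a b ha
    induction a, (by omega : x₀ - 2 ≤ a) using Int.leInduction with
    | base => exact hwest _ _ (by omega)
    | succ a ha' ih =>
      have := hσ.winding_sub hO hY (a + 1) b
      rw [northFlow_eq_zero, add_sub_cancel_right] at this
      · rcases lt_or_ge a (x₀ - 1) with h1 | h1
        · have := hwest a b h1
          linarith
        · have := ih h1
          linarith
      · rw [vert_mem_edgeSet]
        rintro (⟨h', -⟩ | ⟨h', -⟩) <;> have := hy₀ _ h' <;> simp at this <;> omega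
  refine ((Set.finite_Icc (x₀ - 1) x₁).prod (Set.finite_Icc (y₀ - 1) Y)).subset ?_
  rintro ⟨a, b⟩ h
  have h : winding σ O Y a b ≠ 0 := h
  refine ⟨⟨?_, ?_⟩, ?_, ?_⟩ <;> by_contra! hlt <;> apply h
  · exact hwest _ _ hlt
  · exact heast _ _ hlt
  · exact hsouth _ _ hlt
  · have : Finset.Ioc b Y = ∅ := Finset.Ioc_eq_empty (by simp at hlt; omega)
    simp [winding, this]

theorem IsLatticeFlow.cell_subset_intOf_of_winding_ne_zero (hσ : IsLatticeFlow σ)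
    (hO : ∀ v, σ v ∈ O ↔ v ∈ O) (hfin : O.Finite) (hY : ∀ v ∈ O, v.2 ≤ Y)
    (h : winding σ O Y a b ≠ 0) : cell a b ⊆ intOf (curveOf (edgeSet σ O)) := by
  set C := curveOf (edgeSet σ O)
  intro p hp
  have hpC : p ∈ Cᶜ := Set.disjoint_left.1 (disjoint_cell_curveOf a b _) hp
  refine ⟨hpC, ?_⟩
  set T := {c : ℤ × ℤ | winding σ O Y c.1 c.2 ≠ 0}
  have hpT : p ∈ ⋃ c ∈ T, closedCell c := by
    refine Set.mem_biUnion (x := (a, b)) h ?_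
    rw [← closure_cell]
    exact subset_closure hp
  have hdisj : ∀ q ∈ Cᶜ, q ∈ ⋃ c ∈ T, closedCell c → q ∉ ⋃ c ∈ Tᶜ, closedCell c := by
    intro q hqC hq hq'
    simp only [Set.mem_iUnion] at hq hq'
    obtain ⟨c, hc, hqc⟩ := hq
    obtain ⟨d, hd, hqd⟩ := hq'
    exact hd fun h => hc ((hσ.winding_congr hO hY hqc hqd hqC).trans h)
  have hbound : Bornology.IsBounded (⋃ c ∈ T, closedCell c) := by
    refine (Bornology.isBounded_biUnion (hσ.finite_winding_ne_zero hO hfin hY)).2 fun c _ => ?_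
    exact (isCompact_Icc.prod isCompact_Icc).isBounded
  have hsub := connectedComponentIn_subset Cᶜ p
  have hcov : connectedComponentIn Cᶜ p ⊆ (⋃ c ∈ T, closedCell c) ∪ ⋃ c ∈ Tᶜ, closedCell c := by
    intro q hq
    obtain ⟨c, hc⟩ := exists_mem_closedCell q
    by_cases hcT : c ∈ T
    · exact Or.inl (Set.mem_biUnion hcT hc)
    · exact Or.inr (Set.mem_biUnion (s := Tᶜ) hcT hc)
  have hempty : connectedComponentIn Cᶜ p ∩
      ((⋃ c ∈ T, closedCell c) ∩ ⋃ c ∈ Tᶜ, closedCell c) = ∅ :=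
    Set.eq_empty_of_forall_notMem fun q hq => hdisj q (hsub hq.1) hq.2.1 hq.2.2
  rcases isPreconnected_iff_subset_of_disjoint_closed.1
    (isPreconnected_connectedComponentIn (x := p) (F := Cᶜ)) _ _
    (isClosed_biUnion_closedCell T) (isClosed_biUnion_closedCell Tᶜ) hcov hempty with h' | h'
  · exact hbound.subset h'
  · exact absurd (h' (mem_connectedComponentIn hpC)) (hdisj p hpC hpT)

end Winding

theorem snd_le_of_mem_curveOf {σ : Equiv.Perm (ℤ × ℤ)} (hσ : IsLatticeFlow σ)
    {O : Set (ℤ × ℤ)} (hO : ∀ v, σ v ∈ O ↔ v ∈ O) {Y : ℤ} (hY : ∀ v ∈ O, v.2 ≤ Y) :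
    ∀ p ∈ curveOf (edgeSet σ O), p.2 ≤ Y := by
  intro p hp
  obtain ⟨v, hv, -, f, h0, h1, rfl⟩ := hσ.mem_curveOf_edgeSet.1 hp
  have h2 : (v.2 : ℝ) ≤ Y := by exact_mod_cast hY v hv
  have h3 : ((σ v).2 : ℝ) ≤ Y := by exact_mod_cast hY _ ((hO v).2 hv)
  simp only [edgePoint]
  nlinarith

/-- The highest stitches of a finite orbit with interior on the left go west. -/
theorem IsLatticeFlow.exists_west_of_leftCell {σ : Equiv.Perm (ℤ × ℤ)} (hσ : IsLatticeFlow σ)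
    {u : ℤ × ℤ} (hu : σ u ≠ u) (hfin : (orb σ u).Finite)
    (hleft : LeftCell (fun a b => cell a b ⊆ intOf (curveOf (edgeSet σ (orb σ u)))) σ u) :
    ∃ x y, (x, y) ∈ orb σ u ∧ σ (x, y) = (x - 1, y) ∧ ∀ v ∈ orb σ u, v.2 ≤ y := by
  obtain ⟨⟨x, y⟩, hxy, hmax⟩ := hfin.exists_maximalFor Prod.snd _ ⟨u, self_mem_orb σ u⟩
  have hY : ∀ v ∈ orb σ u, v.2 ≤ y := fun v hv => by
    by_contra! h
    exact h.not_ge (hmax hv h.le)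
  have hhor : ∃ x', (x', y) ∈ orb σ u ∧
      (σ (x', y) = (x' + 1, y) ∨ σ (x', y) = (x' - 1, y)) := by
    have hx := hY _ (apply_mem_orb_iff.2 hxy)
    have hne := apply_ne_of_mem_orb hu hxy
    rcases hσ.adj x y with e | e | e | e | e
    · exact absurd e hne
    · exact ⟨x, hxy, Or.inl e⟩
    · exact ⟨x, hxy, Or.inr e⟩
    · rw [e] at hx
      simp at hx
    · obtain ⟨⟨p, q⟩, hpq⟩ := σ.surjective (x, y)
      have hpq' : (p, q) ∈ orb σ u := apply_mem_orb_iff.1 (hpq.symm ▸ hxy)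
      have hq := hY _ hpq'
      have hback := hσ.noBack (p, q)
      have hadj := hσ.adj p q
      have hne' := apply_ne_of_mem_orb hu hpq'
      rw [hpq] at hadj hback hne'
      rw [e] at hback
      simp only [Prod.mk.injEq] at hadj hback hne'
      rcases hadj with e' | e' | e' | e' | e' <;> obtain ⟨rfl, rfl⟩ := e'
      · simp at hne'
      · exact ⟨p, hpq', Or.inl hpq⟩
      · exact ⟨p, hpq', Or.inr hpq⟩
      · simp at hback
      · simp at hq
  obtain ⟨x', hx', e | e⟩ := hhor
  · rw [hσ.leftCell_intOf_iff (self_mem_orb σ u) hx', leftCell_east e] at hleft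
    obtain ⟨p, hp⟩ := cell_nonempty x' y
    exact absurd (hleft hp) (not_mem_intOf_of_lt
      (snd_le_of_mem_curveOf hσ (fun _ => apply_mem_orb_iff) hY) (mem_cell.1 hp).2.1)
  · exact ⟨x', y, hx', e, hY⟩

theorem orb_mul_swap {σ : Equiv.Perm (ℤ × ℤ)} {a b : ℤ × ℤ} (hab : b ∉ orb σ a)
    (hfin : (orb σ a).Finite) : orb (σ * Equiv.swap a b) b = orb σ a ∪ orb σ b := by
  have hta : (σ * Equiv.swap a b) a = σ b := by simp
  have htb : (σ * Equiv.swap a b) b = σ a := by simp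
  have ht : ∀ v, v ≠ a → v ≠ b → (σ * Equiv.swap a b) v = σ v := fun v h h' => by
    simp [Equiv.swap_apply_of_ne_of_ne h h']
  set τ := σ * Equiv.swap a b
  apply Set.Subset.antisymm
  · intro w hw
    refine (iff_of_mem_orb (σ := τ) (Q := fun w => w ∈ orb σ a ∪ orb σ b) (fun v => ?_) hw).2
      (Or.inr (self_mem_orb σ b))
    by_cases h1 : v = a
    · subst h1
      simp [hta, apply_mem_orb_iff, self_mem_orb]
    by_cases h2 : v = b
    · subst h2
      simp [htb, apply_mem_orb_iff, self_mem_orb]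
    · simp [ht v h1 h2, apply_mem_orb_iff]
  · have hb : b ∈ orb τ b := self_mem_orb τ b
    have hσa : σ a ∈ orb τ b := htb ▸ apply_mem_orb_iff.2 hb
    have hiter : ∀ n : ℕ, σ^[n + 1] a ∈ orb τ b := by
      intro n
      induction n with
      | zero => exact hσa
      | succ n ih =>
        rw [Function.iterate_succ_apply']
        by_cases h1 : σ^[n + 1] a = a
        · rw [h1]
          exact hσa
        · have h2 : σ^[n + 1] a ≠ b := fun h => hab ⟨(n + 1 : ℕ), by
            rw [zpow_natCast, Equiv.Perm.coe_pow, h]⟩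
          rw [← ht _ h1 h2]
          exact apply_mem_orb_iff.2 ih
    have ha : a ∈ orb τ b := by
      obtain ⟨n, hn, h⟩ := mem_periodicPts_of_finite_orb hfin
      obtain ⟨m, rfl⟩ := Nat.exists_eq_succ_of_ne_zero hn.ne'
      have := hiter m
      rwa [h] at this
    have hinv : ∀ v, σ v ∈ orb τ b ↔ v ∈ orb τ b := fun v => by
      by_cases h1 : v = a
      · subst h1
        exact iff_of_true hσa ha
      by_cases h2 : v = b
      · subst h2
        exact iff_of_true (hta ▸ apply_mem_orb_iff.2 ha) hb
      · rw [← ht v h1 h2]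
        exact apply_mem_orb_iff
    rintro w (hw | hw)
    · exact (iff_of_mem_orb (Q := fun w => w ∈ orb τ b) hinv hw).2 ha
    · exact (iff_of_mem_orb (Q := fun w => w ∈ orb τ b) hinv hw).2 hb

theorem Orients.agreeableAt {k : ℤ} {σ : Equiv.Perm (ℤ × ℤ)} {S : Set Stitch} (h : Orients k σ S)
    {u : ℤ × ℤ}
    (hleft : LeftCell (fun a b => cell a b ⊆ intOf (curveOf (edgeSet σ (orb σ u)))) σ u) :
    AgreeableAt k (curveOf (edgeSet σ (orb σ u))) := by
  rintro i (hi | hi)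
  · have hs := mid_mem_curveOf.1 (hi (Stitch.mid_mem_seg _))
    rcases vert_mem_edgeSet.1 hs with ⟨-, e⟩ | ⟨hm, e⟩
    · exact absurd e (h.south i)
    · rw [h.flow.leftCell_intOf_iff (self_mem_orb σ u) hm, leftCell_south (by simpa using e),
        add_sub_cancel_right] at hleft
      exact hleft
  · have hs := mid_mem_curveOf.1 (hi (Stitch.mid_mem_seg _))
    rcases vert_mem_edgeSet.1 hs with ⟨hm, e⟩ | ⟨-, e⟩
    · rw [h.flow.leftCell_intOf_iff (self_mem_orb σ u) hm, leftCell_north e,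
        add_sub_cancel_right] at hleft
      exact hleft
    · exact absurd e (h.north i)

/-- An orbit whose highest stitch goes west has its interior on the left. -/
theorem IsLatticeFlow.leftCell_of_west {σ : Equiv.Perm (ℤ × ℤ)} (hσ : IsLatticeFlow σ)
    {u : ℤ × ℤ} (hfin : (orb σ u).Finite) {x y : ℤ} (hxy : (x, y) ∈ orb σ u)
    (hwest : σ (x, y) = (x - 1, y)) (hY : ∀ v ∈ orb σ u, v.2 ≤ y) :
    LeftCell (fun a b => cell a b ⊆ intOf (curveOf (edgeSet σ (orb σ u)))) σ u := by
  rw [hσ.leftCell_intOf_iff (self_mem_orb σ u) hxy, leftCell_west hwest]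
  refine hσ.cell_subset_intOf_of_winding_ne_zero (fun _ => apply_mem_orb_iff) hfin hY ?_
  have hback : σ (x - 1, y) ≠ (x, y) := fun h => by
    have := hσ.noBack (x, y) (by rw [hwest, h])
    rw [hwest] at this
    simp at this
  rw [winding_sub_one hY, westFlow, sub_add_cancel, if_pos ⟨hxy, hwest⟩,
    if_neg fun h => hback h.2]
  simp [winding]

theorem Orients.splice {k j : ℤ} {σ : Equiv.Perm (ℤ × ℤ)} {S T : Set Stitch}
    (h : Orients k σ S) (ha : σ (k, j + 1) = (k, j)) (hb : σ (k + 1, j) = (k + 1, j + 1))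
    (h' : Orients k (σ * Equiv.swap (k, j + 1) (k + 1, j)) T) {u v : ℤ × ℤ}
    (huv : (u = (k, j + 1) ∧ v = (k + 1, j)) ∨ (u = (k + 1, j) ∧ v = (k, j + 1)))
    (hne : v ∉ orb σ u) (hcirc : IsCircle (curveOf (edgeSet σ (orb σ u))))
    (hcell : cell k j ⊆ intOf (curveOf (edgeSet σ (orb σ u)))) {L : Set (ℝ × ℝ)}
    (hL : L = curveOf (edgeSet (σ * Equiv.swap (k, j + 1) (k + 1, j))
      (orb (σ * Equiv.swap (k, j + 1) (k + 1, j)) (k + 1, j)))) :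
    curveOf (edgeSet σ (orb σ v)) ⊆ intOf (curveOf (edgeSet σ (orb σ u))) ∧
      L ⊆ curveOf (edgeSet σ (orb σ u)) ∪ intOf (curveOf (edgeSet σ (orb σ u))) ∧
      IsCircle L ∧ AgreeableAt k L := by
  have hσ := h.flow
  have hfa : σ (k, j + 1) ≠ (k, j + 1) := by simp [ha]
  have hfb : σ (k + 1, j) ≠ (k + 1, j) := by simp [hb]
  have hfu : σ u ≠ u := by rcases huv with ⟨rfl, -⟩ | ⟨rfl, -⟩ <;> assumption
  have hfv : σ v ≠ v := by rcases huv with ⟨-, rfl⟩ | ⟨-, rfl⟩ <;> assumption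
  have hinv : ∀ w x, σ x ∈ orb σ w ↔ x ∈ orb σ w := fun _ _ => apply_mem_orb_iff
  have hdisj : Disjoint (curveOf (edgeSet σ (orb σ v))) (curveOf (edgeSet σ (orb σ u))) := by
    refine hσ.disjoint_curveOf (fun x => (hinv v x).2) (fun x => (hinv u x).2) ?_
    rw [Set.disjoint_left]
    exact fun w hw hw' => hne (Equiv.Perm.SameCycle.trans hw' (Equiv.Perm.SameCycle.symm hw))
  have hleft : LeftCell (fun a b => cell a b ⊆ intOf (curveOf (edgeSet σ (orb σ u)))) σ u := by
    rcases huv with ⟨rfl, -⟩ | ⟨rfl, -⟩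
    · rw [leftCell_south (by simpa using ha), add_sub_cancel_right]
      exact hcell
    · rw [leftCell_north hb, add_sub_cancel_right]
      exact hcell
  obtain ⟨q, hqv, hq⟩ : ∃ q ∈ curveOf (edgeSet σ (orb σ v)), q ∈ closedCell (k, j) := by
    refine ⟨edgePoint σ v 0, hσ.mem_curveOf_edgeSet.2
      ⟨v, self_mem_orb σ v, hfv, 0, le_rfl, zero_le_one, rfl⟩, ?_⟩
    rcases huv with ⟨-, rfl⟩ | ⟨-, rfl⟩ <;> simp [mem_closedCell, edgePoint]
  have hq' := mem_intOf_of_cell_subset hq (Set.disjoint_left.1 hdisj hqv) hcell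
  have hpre := hσ.isPreconnected_orb hfv
  have hsub : curveOf (edgeSet σ (orb σ v)) ⊆ intOf (curveOf (edgeSet σ (orb σ u))) :=
    fun p hp => mem_intOf_of_isPreconnected hpre hdisj hqv hp hq'
  have hfin : ∀ w, σ w ≠ w → Bornology.IsBounded (curveOf (edgeSet σ (orb σ w))) →
      (orb σ w).Finite := fun w hw hbd => finite_of_isBounded_intCast hbd fun x hx =>
    hσ.intCast_mem_curveOf hx (apply_ne_of_mem_orb hw hx)
  have hfinu := hfin u hfu hcirc.isBounded
  have hfinv := hfin v hfv
    (hq'.2.subset (hpre.subset_connectedComponentIn hqv hdisj.subset_compl_right))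
  obtain ⟨x, y, hxy, hwest, hY⟩ := hσ.exists_west_of_leftCell hfu hfinu hleft
  have hYv : ∀ w ∈ orb σ v, w.2 ≤ y := fun w hw => by
    by_contra! hlt
    refine not_mem_intOf_of_lt (snd_le_of_mem_curveOf hσ (hinv u) hY) ?_
      (hsub (hσ.intCast_mem_curveOf hw (apply_ne_of_mem_orb hfv hw)))
    exact Int.cast_lt.2 hlt
  have horb : orb (σ * Equiv.swap (k, j + 1) (k + 1, j)) (k + 1, j) = orb σ u ∪ orb σ v := by
    rcases huv with ⟨rfl, rfl⟩ | ⟨rfl, rfl⟩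
    · exact orb_mul_swap hne hfinu
    · rw [orb_mul_swap (fun h => hne (Equiv.Perm.SameCycle.symm h)) hfinv, Set.union_comm]
  have hta : (σ * Equiv.swap (k, j + 1) (k + 1, j)) (k, j + 1) = (k + 1, j + 1) := by simp [hb]
  have htb : (σ * Equiv.swap (k, j + 1) (k + 1, j)) (k + 1, j) = (k, j) := by simp [ha]
  have ht : ∀ w, w ≠ (k, j + 1) → w ≠ (k + 1, j) →
      (σ * Equiv.swap (k, j + 1) (k + 1, j)) w = σ w := fun w h h' => by
    simp [Equiv.swap_apply_of_ne_of_ne h h']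
  set τ := σ * Equiv.swap (k, j + 1) (k + 1, j)
  have hτ : IsLatticeFlow τ := h'.flow
  have hfτ : τ (k + 1, j) ≠ (k + 1, j) := by simp [htb]
  have hfinτ : (orb τ (k + 1, j)).Finite := horb ▸ hfinu.union hfinv
  have hτwest : τ (x, y) = (x - 1, y) := by
    rw [ht, hwest]
    · rintro ⟨rfl, rfl⟩
      simp [ha] at hwest
    · rintro ⟨rfl, rfl⟩
      simp [hb] at hwest
  have hτleft := hτ.leftCell_of_west hfinτ (horb ▸ Or.inl hxy) hτwest fun w hw => by
    rcases horb ▸ hw with hw | hw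
    · exact hY w hw
    · exact hYv w hw
  subst hL
  refine ⟨hsub, ?_, hσ.isCircle_of_isCircle hτ hfu hfτ hfinu hfinτ hcirc, h'.agreeableAt hτleft⟩
  have hclosed : ∀ p ∈ closedCell (k, j), p ∈ curveOf (edgeSet σ (orb σ u)) ∪
      intOf (curveOf (edgeSet σ (orb σ u))) := fun p hp => by
    by_cases hpu : p ∈ curveOf (edgeSet σ (orb σ u))
    · exact Or.inl hpu
    · exact Or.inr (mem_intOf_of_cell_subset hp hpu hcell)
  intro p hp
  obtain ⟨w, hw, hfw, f, h0, h1, rfl⟩ := hτ.mem_curveOf_edgeSet.1 hp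
  by_cases hwa : w = (k, j + 1)
  · apply hclosed
    simp [hwa, edgePoint, hta, mem_closedCell, h0, h1]
  by_cases hwb : w = (k + 1, j)
  · apply hclosed
    simp [hwb, edgePoint, htb, mem_closedCell, h0, h1]
  have hwσ := ht w hwa hwb
  rw [hwσ] at hfw
  have hp' : edgePoint τ w f = edgePoint σ w f := by simp only [edgePoint, hwσ]
  rw [hp']
  rcases horb ▸ hw with hw | hw
  · exact Or.inl (hσ.mem_curveOf_edgeSet.2 ⟨w, hw, hfw, f, h0, h1, rfl⟩)
  · exact Or.inr (hsub (hσ.mem_curveOf_edgeSet.2 ⟨w, hw, hfw, f, h0, h1, rfl⟩))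

theorem Orients.eq_curveOf_orb {k : ℤ} {σ : Equiv.Perm (ℤ × ℤ)} {S : Set Stitch}
    (h : Orients k σ S) {C : Set (ℝ × ℝ)}
    (hC : ∃ p ∈ curveOf S, C = connectedComponentIn (curveOf S) p)
    {s : Stitch} (hs : s.seg ⊆ C) {v : ℤ × ℤ} (hv : σ v ≠ v) (hsv : s ∈ edgeSet σ (orb σ v)) :
    C = curveOf (edgeSet σ (orb σ v)) := by
  obtain ⟨p, -, rfl⟩ := hC
  rw [connectedComponentIn_eq (hs s.mid_mem_seg), h.edges]
  exact h.flow.connectedComponentIn_eq hv (mid_mem_curveOf.2 hsv)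

/-- Suppose a splice at longitude `k + 1/2` (a local move whose two
deleted vertical stitches lie on different strands) merges an agreeable
pseudo-hitomezashi loop `CL` with a pseudo-hitomezashi strand `CS`, producing the strand
`L'`. Then both `CS` and `L'` are contained in the union of `CL` with its interior, and
`L'` is an agreeable pseudo-hitomezashi loop. (Strands are the connected components of
the union of the stitches of a pseudo-pattern.) -/
theorem hitomezashi_splice (ε η : ℤ → ZMod 2) (k : ℤ) (hk : ε k = ε (k+1))
    (S0 : Set Stitch) (hS0 : IsPseudoPattern ε η k S0) (j : ℤ)
    (hv1 : Stitch.vert k j ∈ S0) (hv2 : Stitch.vert (k+1) j ∈ S0)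
    (hh1 : Stitch.horiz k j ∉ S0) (hh2 : Stitch.horiz k (j+1) ∉ S0)
    (CL CS : Set (ℝ × ℝ))
    (hCL : ∃ p ∈ curveOf S0, CL = connectedComponentIn (curveOf S0) p)
    (hCS : ∃ p ∈ curveOf S0, CS = connectedComponentIn (curveOf S0) p)
    (hne : CL ≠ CS)
    (hLoop : IsCircle CL)
    (hsplice : ((Stitch.vert k j).seg ⊆ CL ∧ (Stitch.vert (k+1) j).seg ⊆ CS) ∨
               ((Stitch.vert (k+1) j).seg ⊆ CL ∧ (Stitch.vert k j).seg ⊆ CS))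
    (hagree : AgreeableAt k CL)
    (S1 : Set Stitch)
    (hS1 : S1 = (S0 \ {Stitch.vert k j, Stitch.vert (k+1) j}) ∪
      {Stitch.horiz k j, Stitch.horiz k (j+1)})
    (L' : Set (ℝ × ℝ))
    (hL' : ∃ p ∈ (Stitch.horiz k j).seg, L' = connectedComponentIn (curveOf S1) p) :
    CS ⊆ CL ∪ intOf CL ∧ L' ⊆ CL ∪ intOf CL ∧ IsCircle L' ∧ AgreeableAt k L' := by
  obtain ⟨σ, h⟩ := hS0.exists_orients hk
  have ha := h.vert_left hv1
  have hb := h.vert_right hv2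
  have h' := h.localMove hv1 hv2 hh1 hh2
  rw [← hS1] at h'
  have hfa : σ (k, j + 1) ≠ (k, j + 1) := by simp [ha]
  have hfb : σ (k + 1, j) ≠ (k + 1, j) := by simp [hb]
  have hsa : Stitch.vert k j ∈ edgeSet σ (orb σ (k, j + 1)) := Or.inr ⟨self_mem_orb σ _, ha⟩
  have hsb : Stitch.vert (k + 1) j ∈ edgeSet σ (orb σ (k + 1, j)) :=
    Or.inl ⟨self_mem_orb σ _, hb⟩
  have hL : L' = curveOf (edgeSet (σ * Equiv.swap (k, j + 1) (k + 1, j))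
      (orb (σ * Equiv.swap (k, j + 1) (k + 1, j)) (k + 1, j))) := by
    obtain ⟨p, hp, rfl⟩ := hL'
    rw [h'.edges]
    refine h'.flow.connectedComponentIn_eq (by simp [ha]) (mem_curveOf.2 ⟨_, ?_, hp⟩)
    exact Or.inr ⟨self_mem_orb _ _, by simp [ha]⟩
  obtain ⟨u, v, huv, rfl, rfl⟩ : ∃ u v, ((u = (k, j + 1) ∧ v = (k + 1, j)) ∨
      (u = (k + 1, j) ∧ v = (k, j + 1))) ∧ CL = curveOf (edgeSet σ (orb σ u)) ∧
      CS = curveOf (edgeSet σ (orb σ v)) := by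
    rcases hsplice with ⟨h1, h2⟩ | ⟨h1, h2⟩
    · exact ⟨_, _, Or.inl ⟨rfl, rfl⟩, h.eq_curveOf_orb hCL h1 hfa hsa,
        h.eq_curveOf_orb hCS h2 hfb hsb⟩
    · exact ⟨_, _, Or.inr ⟨rfl, rfl⟩, h.eq_curveOf_orb hCL h1 hfb hsb,
        h.eq_curveOf_orb hCS h2 hfa hsa⟩
  have hnot : v ∉ orb σ u := fun hv => hne <| by
    have : orb σ u = orb σ v := Set.ext fun w =>
      ⟨fun hw => Equiv.Perm.SameCycle.trans (Equiv.Perm.SameCycle.symm hv) hw,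
        fun hw => Equiv.Perm.SameCycle.trans hv hw⟩
    rw [this]
  have hcell := hagree j (hsplice.imp And.left And.left)
  obtain ⟨h1, h2⟩ := h.splice ha hb h' huv hnot hLoop hcell hL
  exact ⟨h1.trans Set.subset_union_right, h2⟩
end
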